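/- Let X₁, …, X_N be C_b^∞-vector fields on ℝ^d satisfying the uniform Hörmander condition of order r. Then there exists c > 0 such that ‖Δ^{1/(2r)}φ‖₂² ≤ c ( ‖φ‖₂² + Σ_{i=1}^N ‖X_iφ‖₂² ) for all φ ∈ C_c^∞(ℝ^d); that is, the operator H₀ = Σ_{i=1}^N X_i^* X_i is subelliptic of order 1/r. -/

import Mathlib

open MeasureTheory Complex Real Finset FourierTransform

noncomputable section

/-- Euclidean space `ℝ^d`. -/
abbrev Ec (d : ℕ) := EuclideanSpace ℝ (Fin d)

variable {d : ℕ}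

/-- The `L²` norm of a complex-valued function. -/
def l2norm (f : Ec d → ℂ) : ℝ := (∫ x, ‖f x‖ ^ 2).sqrt

/-- Smooth compactly supported test functions. -/
def IsCc (φ : Ec d → ℂ) : Prop := ContDiff ℝ (⊤ : ℕ∞) φ ∧ HasCompactSupport φ

/-- A `C_b^∞`-vector field on `ℝ^d`: a smooth coefficient map `a : ℝ^d → ℝ^d` which is
bounded together with all its derivatives. -/
def IsCbVF (a : Ec d → Ec d) : Prop :=
  ContDiff ℝ (⊤ : ℕ∞) a ∧ ∀ n : ℕ, ∃ C : ℝ, ∀ x, ‖iteratedFDeriv ℝ n a x‖ ≤ C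

/-- `f` is the (smooth, globally defined) flow `f t x = exp(tX)(x)` of the vector field
with coefficient map `a`:  `f 0 x = x` and `∂_t f t x = a (f t x)`. -/
def IsFlowOf (a : Ec d → Ec d) (f : ℝ → Ec d → Ec d) : Prop :=
  ContDiff ℝ (⊤ : ℕ∞) (fun p : ℝ × Ec d => f p.1 p.2) ∧
    (∀ x, f 0 x = x) ∧
    ∀ t x, HasDerivAt (fun s => f s x) (a (f t x)) t

/-- A smooth real-valued function which is bounded together with all its derivatives. -/
def IsCbR (ψ : Ec d → ℝ) : Prop :=
  ContDiff ℝ (⊤ : ℕ∞) ψ ∧ ∀ n : ℕ, ∃ C : ℝ, ∀ x, ‖iteratedFDeriv ℝ n ψ x‖ ≤ C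

/-- The commutator `[X,Y]` of vector fields, as coefficient maps:
`[X,Y] = ∑_k (X b_k - Y a_k) ∂_k`. -/
def vfComm (a b : Ec d → Ec d) : Ec d → Ec d :=
  fun x => fderiv ℝ b x (a x) - fderiv ℝ a x (b x)

/-- The iterated commutator `X_{[α]} = [X_{i₁},[X_{i₂},…,[X_{i_{n-1}},X_{i_n}]…]]`
associated with a multi-index `α` given as a list. -/
def multiComm {ι : Type*} (X : ι → Ec d → Ec d) : List ι → (Ec d → Ec d)
  | [] => fun _ => 0
  | [i] => X i
  | i :: j :: l => vfComm (X i) (multiComm X (j :: l))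

/-- The uniform Hörmander condition of order `r`: every `C_b^∞`-vector field is a
`C_b^∞(ℝ^d)`-linear combination of the multi-commutators `X_{[α]}` with `1 ≤ |α| ≤ r`. -/
def UniformHormander {d N : ℕ} (X : Fin N → Ec d → Ec d) (r : ℕ) : Prop :=
  ∀ a : Ec d → Ec d, IsCbVF a →
    ∃ ψ : List (Fin N) → (Ec d → ℝ), (∀ l, IsCbR (ψ l)) ∧
      ∀ x, a x = ∑ k ∈ Finset.Icc 1 r, ∑ v : Fin k → Fin N,
        ψ (List.ofFn v) x • multiComm X (List.ofFn v) x

/-- A vector field acting on a function: `Xφ = ∑_k a_k ∂_k φ = (Dφ)(a)`. -/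
def vfApply (a : Ec d → Ec d) (φ : Ec d → ℂ) : Ec d → ℂ :=
  fun x => fderiv ℝ φ x (a x)

/-! ### Smooth functions with bounded derivatives -/

/-- Smooth functions on `ℝ^d` all of whose derivatives are bounded. -/
def BddSmooth {F : Type*} [NormedAddCommGroup F] [NormedSpace ℝ F] (f : Ec d → F) : Prop :=
  ContDiff ℝ (⊤ : ℕ∞) f ∧ ∀ n : ℕ, ∃ C : ℝ, ∀ x, ‖iteratedFDeriv ℝ n f x‖ ≤ C

section BddSmooth

variable {F G H : Type*} [NormedAddCommGroup F] [NormedSpace ℝ F] [NormedAddCommGroup G]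
  [NormedSpace ℝ G] [NormedAddCommGroup H] [NormedSpace ℝ H]

theorem BddSmooth.exists_bound {f : Ec d → F} (hf : BddSmooth f) :
    ∃ C : ℝ, 0 ≤ C ∧ ∀ x, ‖f x‖ ≤ C := by
  obtain ⟨C, hC⟩ := hf.2 0
  refine ⟨C, (norm_nonneg _).trans (hC 0), fun x => ?_⟩
  simpa using hC x

theorem BddSmooth.fderiv {f : Ec d → F} (hf : BddSmooth f) : BddSmooth (fderiv ℝ f) := by
  refine ⟨hf.1.fderiv_right (by simp), fun n => ?_⟩
  obtain ⟨C, hC⟩ := hf.2 (n + 1)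
  exact ⟨C, fun x => by rw [norm_iteratedFDeriv_fderiv]; exact hC x⟩

theorem BddSmooth.bilin {f : Ec d → F} {g : Ec d → G} (B : F →L[ℝ] G →L[ℝ] H)
    (hf : BddSmooth f) (hg : BddSmooth g) : BddSmooth (fun x => B (f x) (g x)) := by
  refine ⟨B.isBoundedBilinearMap.contDiff.comp (hf.1.prodMk hg.1), fun n => ?_⟩
  choose C hC using hf.2
  choose C' hC' using hg.2
  refine ⟨‖B‖ * ∑ i ∈ Finset.range (n + 1), (n.choose i : ℝ) * C i * C' (n - i), fun x => ?_⟩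
  refine (B.norm_iteratedFDeriv_le_of_bilinear hf.1 hg.1 x (n := n)
    (by exact_mod_cast le_top)).trans ?_
  have h0 : ∀ i, 0 ≤ C i := fun i => (norm_nonneg _).trans (hC i x)
  gcongr with i hi
  · exact mul_nonneg (by positivity) (h0 i)
  · exact hC i x
  · exact hC' _ x

theorem BddSmooth.clm_apply {f : Ec d → (F →L[ℝ] G)} {g : Ec d → F}
    (hf : BddSmooth f) (hg : BddSmooth g) : BddSmooth (fun x => f x (g x)) :=
  hf.bilin (ContinuousLinearMap.id ℝ (F →L[ℝ] G)) hg

theorem BddSmooth.const (c : F) : BddSmooth (fun _ : Ec d => c) := by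
  refine ⟨contDiff_const, fun n => ?_⟩
  rcases n with _ | n
  · exact ⟨‖c‖, fun x => by simp⟩
  · exact ⟨0, fun x => by simp [iteratedFDeriv_const_of_ne (𝕜 := ℝ) (Nat.succ_ne_zero n) c]⟩

theorem BddSmooth.add {f g : Ec d → F} (hf : BddSmooth f) (hg : BddSmooth g) :
    BddSmooth (fun x => f x + g x) := by
  refine ⟨hf.1.add hg.1, fun n => ?_⟩
  obtain ⟨C, hC⟩ := hf.2 n
  obtain ⟨C', hC'⟩ := hg.2 n
  refine ⟨C + C', fun x => ?_⟩
  rw [fun_iteratedFDeriv_add (hf.1.of_le (by exact_mod_cast le_top))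
    (hg.1.of_le (by exact_mod_cast le_top))]
  exact (norm_add_le _ _).trans (add_le_add (hC x) (hC' x))

theorem BddSmooth.clm_comp {f : Ec d → F} (L : F →L[ℝ] G) (hf : BddSmooth f) :
    BddSmooth (fun x => L (f x)) :=
  (BddSmooth.const (d := d) L).clm_apply hf

theorem BddSmooth.smul {f : Ec d → F} (c : ℝ) (hf : BddSmooth f) :
    BddSmooth (fun x => c • f x) :=
  hf.clm_comp (c • ContinuousLinearMap.id ℝ F)

theorem BddSmooth.sub {f g : Ec d → F} (hf : BddSmooth f) (hg : BddSmooth g) :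
    BddSmooth (fun x => f x - g x) := by
  simpa [sub_eq_add_neg] using hf.add (hg.smul (-1))

theorem BddSmooth.neg {f : Ec d → F} (hf : BddSmooth f) : BddSmooth (fun x => -f x) := by
  simpa using hf.smul (-1)

theorem BddSmooth.vfComm {a b : Ec d → Ec d} (ha : BddSmooth a) (hb : BddSmooth b) :
    BddSmooth (vfComm a b) :=
  (hb.fderiv.clm_apply ha).sub (ha.fderiv.clm_apply hb)

theorem BddSmooth.multiComm {ι : Type*} {X : ι → Ec d → Ec d} (hX : ∀ i, BddSmooth (X i)) :
    ∀ l : List ι, BddSmooth (multiComm X l)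
  | [] => BddSmooth.const 0
  | [i] => hX i
  | i :: j :: l => (hX i).vfComm (BddSmooth.multiComm hX (j :: l))

theorem BddSmooth.hasTemperateGrowth {f : Ec d → F} (hf : BddSmooth f) :
    f.HasTemperateGrowth := by
  refine ⟨hf.1, fun n => ?_⟩
  obtain ⟨C, hC⟩ := hf.2 n
  exact ⟨0, C, fun x => by simpa using hC x⟩

end BddSmooth

variable (d) in
/-- Smooth maps `ℝ^d → ℝ^d` all of whose derivatives of positive order are bounded. -/
def slowMaps : Submodule ℝ (Ec d → Ec d) where
  carrier := {h | ContDiff ℝ (⊤ : ℕ∞) h ∧ BddSmooth (fderiv ℝ h)}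
  add_mem' := by
    rintro f g ⟨hf, hf'⟩ ⟨hg, hg'⟩
    refine ⟨hf.add hg, ?_⟩
    have : fderiv ℝ (f + g) = fun x => fderiv ℝ f x + fderiv ℝ g x := by
      ext1 x
      exact fderiv_add (hf.differentiable (by simp) x) (hg.differentiable (by simp) x)
    rw [this]
    exact hf'.add hg'
  zero_mem' := ⟨contDiff_const, (BddSmooth.const (0 : Ec d)).fderiv⟩
  smul_mem' := by
    rintro c f ⟨hf, hf'⟩
    refine ⟨hf.const_smul c, ?_⟩
    have : fderiv ℝ (c • f) = fun x => c • fderiv ℝ f x := by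
      ext1 x
      exact fderiv_const_smul (hf.differentiable (by simp) x) c
    rw [this]
    exact hf'.smul c

theorem slowMaps.differentiable (h : slowMaps d) : Differentiable ℝ (h : Ec d → Ec d) :=
  h.2.1.differentiable (by simp)

theorem BddSmooth.mem_slowMaps {f : Ec d → Ec d} (hf : BddSmooth f) : f ∈ slowMaps d :=
  ⟨hf.1, hf.fderiv⟩

variable (d) in
/-- The identity map as an element of `slowMaps`. -/
def slowId : slowMaps d :=
  ⟨fun x => x, contDiff_id, by
    have : fderiv ℝ (fun x : Ec d => x) = fun _ => ContinuousLinearMap.id ℝ (Ec d) := by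
      ext1 x; exact fderiv_fun_id
    rw [this]
    exact BddSmooth.const _⟩

/-- A vector field acting as a derivation on `slowMaps`. -/
def vfOp (a : Ec d → Ec d) (ha : BddSmooth a) : Module.End ℝ (slowMaps d) where
  toFun h := ⟨fun x => fderiv ℝ (h : Ec d → Ec d) x (a x), (h.2.2.clm_apply ha).mem_slowMaps⟩
  map_add' f g := by
    ext1
    funext x
    change fderiv ℝ ((f : Ec d → Ec d) + (g : Ec d → Ec d)) x (a x) = _
    rw [fderiv_add (slowMaps.differentiable f x) (slowMaps.differentiable g x)]
    rfl
  map_smul' c f := by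
    ext1
    funext x
    change fderiv ℝ (c • (f : Ec d → Ec d)) x (a x) = _
    rw [fderiv_const_smul (slowMaps.differentiable f x) c]
    rfl

theorem vfOp_apply (a : Ec d → Ec d) (ha : BddSmooth a) (h : slowMaps d) (x : Ec d) :
    (vfOp a ha h : Ec d → Ec d) x = fderiv ℝ (h : Ec d → Ec d) x (a x) := rfl

theorem bddSmooth_vfOp (a : Ec d → Ec d) (ha : BddSmooth a) (h : slowMaps d) :
    BddSmooth (vfOp a ha h : Ec d → Ec d) := h.2.2.clm_apply ha

theorem vfOp_slowId (a : Ec d → Ec d) (ha : BddSmooth a) :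
    (vfOp a ha (slowId d) : Ec d → Ec d) = a := by
  funext x
  rw [vfOp_apply]
  change fderiv ℝ (fun x : Ec d => x) x (a x) = a x
  simp

theorem vfOp_neg (a : Ec d → Ec d) (ha : BddSmooth a) :
    vfOp (fun x => -a x) ha.neg = -vfOp a ha := by
  ext h x i
  simp [vfOp_apply]

theorem vfOp_vfComm (a b : Ec d → Ec d) (ha : BddSmooth a) (hb : BddSmooth b) :
    vfOp (vfComm a b) (ha.vfComm hb) = vfOp a ha * vfOp b hb - vfOp b hb * vfOp a ha := by
  ext1 h
  ext1
  funext x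
  have hd : ∀ x, DifferentiableAt ℝ (fderiv ℝ (h : Ec d → Ec d)) x :=
    h.2.2.1.differentiable (by simp)
  have hab : ∀ {c : Ec d → Ec d}, BddSmooth c → ∀ v, fderiv ℝ
      (fun y => fderiv ℝ (h : Ec d → Ec d) y (c y)) x v =
      fderiv ℝ (fderiv ℝ (h : Ec d → Ec d)) x v (c x) +
        fderiv ℝ (h : Ec d → Ec d) x (fderiv ℝ c x v) := by
    intro c hc v
    rw [fderiv_clm_apply (hd x) (hc.1.differentiable (by simp) x)]
    simp [add_comm]
  have hs : IsSymmSndFDerivAt ℝ (h : Ec d → Ec d) x :=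
    (h.2.1.contDiffAt).isSymmSndFDerivAt (by
      rw [minSmoothness_of_isRCLikeNormedField]
      exact WithTop.coe_le_coe.2 (le_top (a := (2 : ℕ∞))))
  change fderiv ℝ (h : Ec d → Ec d) x (vfComm a b x) =
    fderiv ℝ (fun y => fderiv ℝ (h : Ec d → Ec d) y (b y)) x (a x) -
    fderiv ℝ (fun y => fderiv ℝ (h : Ec d → Ec d) y (a y)) x (b x)
  rw [hab hb, hab ha, hs (a x) (b x), vfComm, map_sub]
  abel

/-! ### Bounds in `L²` -/

section L2

variable {F G : Type*} [NormedAddCommGroup F] [NormedAddCommGroup G]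

/-- `f` is measurable and its `L²` norm is at most the nonnegative real number `B`. -/
def L2le (f : Ec d → F) (B : ℝ) : Prop :=
  AEStronglyMeasurable f volume ∧ 0 ≤ B ∧ eLpNorm f 2 volume ≤ ENNReal.ofReal B

theorem L2le.mono {f : Ec d → F} {A B : ℝ} (hf : L2le f A) (h : A ≤ B) : L2le f B :=
  ⟨hf.1, hf.2.1.trans h, hf.2.2.trans (ENNReal.ofReal_le_ofReal h)⟩

theorem L2le.add {f g : Ec d → F} {A B : ℝ} (hf : L2le f A) (hg : L2le g B) :
    L2le (fun x => f x + g x) (A + B) := by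
  refine ⟨hf.1.add hg.1, add_nonneg hf.2.1 hg.2.1, ?_⟩
  rw [ENNReal.ofReal_add hf.2.1 hg.2.1]
  exact (eLpNorm_add_le hf.1 hg.1 (by norm_num)).trans (add_le_add hf.2.2 hg.2.2)

theorem L2le.of_norm_le {f : Ec d → F} {g : Ec d → G} {A : ℝ} (hf : L2le f A)
    (hg : AEStronglyMeasurable g volume) (h : ∀ x, ‖g x‖ ≤ ‖f x‖) : L2le g A :=
  ⟨hg, hf.2.1, (eLpNorm_mono h).trans hf.2.2⟩

theorem L2le.norm {f : Ec d → F} {A : ℝ} (hf : L2le f A) : L2le (fun x => ‖f x‖) A :=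
  hf.of_norm_le hf.1.norm (fun x => by simp)

theorem L2le.const_mul {f : Ec d → ℝ} {A c : ℝ} (hf : L2le f A) (hc : 0 ≤ c) :
    L2le (fun x => c * f x) (c * A) := by
  refine ⟨hf.1.const_mul c, mul_nonneg hc hf.2.1, ?_⟩
  have : (fun x => c * f x) = c • f := rfl
  rw [this, eLpNorm_const_smul, ENNReal.ofReal_mul hc, Real.enorm_eq_ofReal hc]
  gcongr
  exact hf.2.2

theorem L2le.zero : L2le (fun _ : Ec d => (0 : F)) 0 :=
  ⟨aestronglyMeasurable_const, le_rfl, by simp⟩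

theorem L2le.sum {ι : Type*} (s : Finset ι) {f : ι → Ec d → F} {A : ι → ℝ}
    (h : ∀ i ∈ s, L2le (f i) (A i)) : L2le (fun x => ∑ i ∈ s, f i x) (∑ i ∈ s, A i) := by
  classical
  induction s using Finset.induction_on with
  | empty => simpa using L2le.zero
  | insert a s ha ih =>
    simp only [Finset.sum_insert ha]
    exact (h a (by simp)).add (ih fun i hi => h i (by simp [hi]))

theorem L2le.of_le_mul {f : Ec d → F} {g : Ec d → G} {A c : ℝ} (hf : L2le f A) (hc : 0 ≤ c)
    (hg : AEStronglyMeasurable g volume) (h : ∀ x, ‖g x‖ ≤ c * ‖f x‖) : L2le g (c * A) :=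
  (hf.norm.const_mul hc).of_norm_le hg fun x => by
    rw [norm_mul, norm_norm, Real.norm_of_nonneg hc]; exact h x

theorem eLpNorm_two_sq (f : Ec d → F) :
    eLpNorm f 2 volume ^ 2 = ∫⁻ x, ‖f x‖ₑ ^ 2 := by
  have := eLpNorm_nnreal_pow_eq_lintegral (f := f) (μ := volume) (p := 2) (by norm_num)
  simpa using this

theorem l2le_of_lintegral_le {f : Ec d → F} {B : ℝ} (hf : AEStronglyMeasurable f volume)
    (hB : 0 ≤ B) (h : ∫⁻ x, ‖f x‖ₑ ^ 2 ≤ ENNReal.ofReal B ^ 2) : L2le f B := by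
  refine ⟨hf, hB, ?_⟩
  rw [← eLpNorm_two_sq] at h
  exact (ENNReal.pow_le_pow_left_iff (by norm_num)).1 h

theorem L2le.lintegral_le {f : Ec d → F} {B : ℝ} (hf : L2le f B) :
    ∫⁻ x, ‖f x‖ₑ ^ 2 ≤ ENNReal.ofReal B ^ 2 := by
  rw [← eLpNorm_two_sq]
  gcongr
  exact hf.2.2

/-- Minkowski's integral inequality on a segment. -/
theorem L2le.of_integral {f : Ec d → F} {g : ℝ → Ec d → G} {s B : ℝ} (hs : 0 ≤ s)
    (hf : AEStronglyMeasurable f volume) (hg : Continuous (Function.uncurry g))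
    (hB : ∀ σ ∈ Set.Ioc 0 s, L2le (g σ) B) (hB0 : 0 ≤ B)
    (h : ∀ x, ‖f x‖ ≤ ∫ σ in (0 : ℝ)..s, ‖g σ x‖) : L2le f (s * B) := by
  refine l2le_of_lintegral_le hf (mul_nonneg hs hB0) ?_
  have hm : Measurable (fun p : ℝ × Ec d => ‖g p.1 p.2‖ₑ) := hg.enorm.measurable
  have hpt : ∀ x, ‖f x‖ₑ ^ 2 ≤
      ENNReal.ofReal s * ∫⁻ σ in Set.Ioc 0 s, ‖g σ x‖ₑ ^ 2 := by
    intro x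
    have hgx : Continuous fun σ => g σ x := hg.comp (Continuous.prodMk_left x)
    have h1 : ‖f x‖ₑ ≤ ∫⁻ σ in Set.Ioc 0 s, ‖g σ x‖ₑ := by
      rw [← ofReal_norm]
      refine (ENNReal.ofReal_le_ofReal (h x)).trans ?_
      rw [intervalIntegral.integral_of_le hs, ofReal_integral_eq_lintegral_ofReal
        (by exact (hgx.norm.integrableOn_Icc (a := 0) (b := s)).mono_set Set.Ioc_subset_Icc_self)
        (Filter.Eventually.of_forall fun _ => norm_nonneg _)]
      simp
    have h2 := ENNReal.lintegral_mul_le_Lp_mul_Lq (volume.restrict (Set.Ioc 0 s))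
      (Real.HolderConjugate.two_two) (f := fun σ => ‖g σ x‖ₑ) (g := fun _ => 1)
      hgx.enorm.measurable.aemeasurable aemeasurable_const
    calc ‖f x‖ₑ ^ 2 ≤ (∫⁻ σ in Set.Ioc 0 s, ‖g σ x‖ₑ) ^ 2 := by gcongr
      _ ≤ ((∫⁻ σ in Set.Ioc 0 s, ‖g σ x‖ₑ ^ (2 : ℝ)) ^ (1 / (2 : ℝ)) *
          (ENNReal.ofReal s) ^ (1 / (2 : ℝ))) ^ 2 := by
        gcongr
        simpa using h2
      _ = _ := by
        rw [mul_pow, ← ENNReal.rpow_natCast, ← ENNReal.rpow_natCast, ← ENNReal.rpow_mul,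
          ← ENNReal.rpow_mul]
        simp [mul_comm]
  calc ∫⁻ x, ‖f x‖ₑ ^ 2
      ≤ ∫⁻ x, ENNReal.ofReal s * ∫⁻ σ in Set.Ioc 0 s, ‖g σ x‖ₑ ^ 2 := lintegral_mono hpt
    _ = ENNReal.ofReal s * ∫⁻ x, ∫⁻ σ in Set.Ioc 0 s, ‖g σ x‖ₑ ^ 2 :=
        lintegral_const_mul' _ _ ENNReal.ofReal_ne_top
    _ = ENNReal.ofReal s * ∫⁻ σ in Set.Ioc 0 s, ∫⁻ x, ‖g σ x‖ₑ ^ 2 := by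
        rw [lintegral_lintegral_swap]
        exact ((hm.comp measurable_swap).pow_const 2).aemeasurable
    _ ≤ ENNReal.ofReal s * ∫⁻ σ in Set.Ioc 0 s, ENNReal.ofReal B ^ 2 := by
        gcongr 1
        exact setLIntegral_mono measurable_const fun σ hσ => (hB σ hσ).lintegral_le
    _ = ENNReal.ofReal (s * B) ^ 2 := by
        rw [ENNReal.ofReal_mul hs]
        simp
        ring

theorem volume_preimage_le_of_antilipschitz {W : Ec d → Ec d} (hW : AntilipschitzWith 2 W)
    (s : Set (Ec d)) : volume (W ⁻¹' s) ≤ 2 ^ d * volume s := by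
  obtain ⟨c, hc⟩ : ∃ c : NNReal, (volume : Measure (Ec d)) =
      c • Measure.hausdorffMeasure (Module.finrank ℝ (Ec d)) :=
    ⟨_, Measure.isAddLeftInvariant_eq_smul _ _⟩
  have h := hW.hausdorffMeasure_preimage_le (d := Module.finrank ℝ (Ec d)) (by positivity) s
  rw [hc]
  simp only [Measure.smul_apply, ENNReal.smul_def, smul_eq_mul]
  calc _ ≤ c * (((2 : NNReal) : ENNReal) ^ ((Module.finrank ℝ (Ec d) : ℕ) : ℝ) *
        Measure.hausdorffMeasure (Module.finrank ℝ (Ec d)) s) := by gcongr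
    _ = _ := by
      rw [ENNReal.rpow_natCast, finrank_euclideanSpace_fin]
      push_cast
      ring

theorem antilipschitzWith_of_lipschitzWith_sub_id {W : Ec d → Ec d} {c : ℝ} (hc : c ≤ 1 / 2)
    (hW : ∀ x y, ‖(W x - x) - (W y - y)‖ ≤ c * ‖x - y‖) : AntilipschitzWith 2 W := by
  refine AntilipschitzWith.of_le_mul_dist fun x y => ?_
  have h1 : ‖(W x - x) - (W y - y)‖ ≤ 1 / 2 * ‖x - y‖ :=
    (hW x y).trans (by gcongr)
  have h2 : ‖x - y‖ ≤ ‖W x - W y‖ + ‖(W x - x) - (W y - y)‖ := by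
    have : x - y = (W x - W y) - ((W x - x) - (W y - y)) := by abel
    rw [this]
    exact norm_sub_le _ _
  rw [dist_eq_norm, dist_eq_norm]
  push_cast
  linarith

variable (d) in
/-- A bound for the `L²` operator norm of composition with near-identity maps. -/
def compConst : ℝ := Real.sqrt (2 ^ d)

theorem compConst_nonneg : 0 ≤ compConst d := Real.sqrt_nonneg _

theorem L2le.comp {f : Ec d → F} {A : ℝ} (hf : L2le f A) {W : Ec d → Ec d}
    (hWc : Continuous W) (hW : AntilipschitzWith 2 W) :
    L2le (fun x => f (W x)) (compConst d * A) := by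
  have hle : Measure.map W volume ≤ (2 ^ d : ENNReal) • (volume : Measure (Ec d)) := by
    refine Measure.le_iff.2 fun s hs => ?_
    rw [Measure.map_apply hWc.measurable hs]
    exact volume_preimage_le_of_antilipschitz hW s
  have hf' : AEStronglyMeasurable f (Measure.map W volume) :=
    hf.1.mono_ac (Measure.absolutelyContinuous_of_le_smul hle)
  refine ⟨hf'.comp_measurable hWc.measurable, mul_nonneg compConst_nonneg hf.2.1, ?_⟩
  have h1 : eLpNorm (fun x => f (W x)) 2 volume = eLpNorm f 2 (Measure.map W volume) :=
    (eLpNorm_map_measure hf' hWc.aemeasurable).symm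
  rw [h1]
  refine (eLpNorm_mono_measure f hle).trans ?_
  rw [eLpNorm_smul_measure_of_ne_top (by norm_num), ENNReal.ofReal_mul compConst_nonneg,
    smul_eq_mul]
  gcongr ?_ * ?_
  · apply le_of_eq
    rw [compConst, Real.sqrt_eq_rpow, ← ENNReal.ofReal_rpow_of_nonneg (by positivity) (by norm_num),
      ENNReal.ofReal_pow (by norm_num)]
    simp
  · exact hf.2.2

end L2

/-! ### Transport maps and their formal expansions -/

/-- A family `W s` of near-identity maps whose pullback has the formal expansion
`∑ sⁿ Aₙ`, up to the order `M`, and which moves functions by at most `O(s)` in `L²`, measured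
by their derivatives along the fields `X i`. -/
structure IsTransport {N : ℕ} (X : Fin N → Ec d → Ec d) (M : ℕ) (W : ℝ → Ec d → Ec d)
    (A : PowerSeries (Module.End ℝ (slowMaps d))) : Prop where
  lip : ∃ C : ℝ, 0 ≤ C ∧ ∀ s ∈ Set.Ioc (0 : ℝ) 1, ∀ x y,
    ‖(W s x - x) - (W s y - y)‖ ≤ C * s * ‖x - y‖
  expand : ∀ (h : slowMaps d) (k : ℕ), 1 ≤ k → k ≤ M + 1 → ∃ C : ℝ, 0 ≤ C ∧
    ∀ s ∈ Set.Ioc (0 : ℝ) 1, ∀ x, ‖(h : Ec d → Ec d) (W s x) -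
      ∑ n ∈ Finset.range k, s ^ n • (PowerSeries.coeff n A h : Ec d → Ec d) x‖ ≤ C * s ^ k
  cost : ∃ C s₀ : ℝ, 0 ≤ C ∧ 0 < s₀ ∧ ∀ s ∈ Set.Ioc (0 : ℝ) s₀, ∀ u : Ec d → ℂ,
    ContDiff ℝ (⊤ : ℕ∞) u → ∀ e g : ℝ, (∀ i, L2le (vfApply (X i) u) e) →
    0 ≤ e → L2le (fderiv ℝ u) g →
    L2le (fun x => u (W s x) - u x) (C * (s * e + s ^ (M + 1) * g))

theorem continuous_of_lipschitz_sub_id {W : Ec d → Ec d} {c : ℝ}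
    (hW : ∀ x y, ‖(W x - x) - (W y - y)‖ ≤ c * ‖x - y‖) : Continuous W := by
  have h : LipschitzWith (Real.toNNReal c) (fun x => W x - x) :=
    LipschitzWith.of_dist_le' fun x y => by
      rw [dist_eq_norm, dist_eq_norm]; exact hW x y
  have := h.continuous.add continuous_id
  rwa [show ((fun x => W x - x) + id) = W by ext1 x; simp] at this

theorem IsTransport.exists_antilipschitz {N : ℕ} {X : Fin N → Ec d → Ec d} {M : ℕ}
    {W : ℝ → Ec d → Ec d} {A : PowerSeries (Module.End ℝ (slowMaps d))}
    (hW : IsTransport X M W A) : ∃ s₀ : ℝ, 0 < s₀ ∧ s₀ ≤ 1 ∧ ∀ s ∈ Set.Ioc (0 : ℝ) s₀,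
      Continuous (W s) ∧ AntilipschitzWith 2 (W s) ∧
      ∀ x y, ‖(W s x - x) - (W s y - y)‖ ≤ 1 / 2 * ‖x - y‖ := by
  obtain ⟨C, hC, h⟩ := hW.lip
  have h0 : (0 : ℝ) < 1 / (2 * (C + 1)) := by positivity
  refine ⟨min 1 (1 / (2 * (C + 1))), lt_min one_pos h0, min_le_left _ _, fun s hs => ?_⟩
  have hs1 : s ∈ Set.Ioc (0 : ℝ) 1 := ⟨hs.1, hs.2.trans (min_le_left _ _)⟩
  have hs2 : C * s ≤ 1 / 2 := by
    have h1 : s ≤ 1 / (2 * (C + 1)) := hs.2.trans (min_le_right _ _)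
    rw [le_div_iff₀ (by positivity)] at h1
    nlinarith [hs.1]
  have h2 : ∀ x y, ‖(W s x - x) - (W s y - y)‖ ≤ 1 / 2 * ‖x - y‖ := fun x y =>
    (h s hs1 x y).trans (by gcongr)
  exact ⟨continuous_of_lipschitz_sub_id h2, antilipschitzWith_of_lipschitzWith_sub_id le_rfl h2, h2⟩

theorem aestronglyMeasurable_comp_sub {u : Ec d → ℂ} (hu : Continuous u) {W : Ec d → Ec d}
    (hW : Continuous W) : AEStronglyMeasurable (fun x => u (W x) - u x) volume :=
  ((hu.comp hW).sub hu).aestronglyMeasurable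

theorem IsTransport.comp {N : ℕ} {X : Fin N → Ec d → Ec d} {M : ℕ}
    {W V : ℝ → Ec d → Ec d} {A B : PowerSeries (Module.End ℝ (slowMaps d))}
    (hW : IsTransport X M W A) (hV : IsTransport X M V B) :
    IsTransport X M (fun s x => W s (V s x)) (B * A) where
  lip := by
    obtain ⟨C, hC, h⟩ := hW.lip
    obtain ⟨C', hC', h'⟩ := hV.lip
    refine ⟨C * (1 + C') + C', by positivity, fun s hs x y => ?_⟩
    have h1 := h s hs (V s x) (V s y)
    have h2 := h' s hs x y
    have h3 : ‖V s x - V s y‖ ≤ (1 + C') * ‖x - y‖ := by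
      have : V s x - V s y = ((V s x - x) - (V s y - y)) + (x - y) := by abel
      rw [this]
      refine (norm_add_le _ _).trans ?_
      have : C' * s * ‖x - y‖ ≤ C' * 1 * ‖x - y‖ := by gcongr; exact hs.2
      linarith
    have h4 : W s (V s x) - x - (W s (V s y) - y) =
        ((W s (V s x) - V s x) - (W s (V s y) - V s y)) + ((V s x - x) - (V s y - y)) := by abel
    rw [h4]
    refine (norm_add_le _ _).trans ?_
    have h5 : C * s * ‖V s x - V s y‖ ≤ C * s * ((1 + C') * ‖x - y‖) := by
      gcongr
      exact mul_nonneg hC hs.1.le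
    nlinarith
  expand := by
    intro h k hk hkM
    obtain ⟨C, hC, hC'⟩ := hW.expand h k hk hkM
    have hn : ∀ n, ∃ D : ℝ, 0 ≤ D ∧ (n < k → ∀ s ∈ Set.Ioc (0 : ℝ) 1, ∀ x,
        ‖(PowerSeries.coeff n A h : Ec d → Ec d) (V s x) - ∑ m ∈ Finset.range (k - n), s ^ m •
          (PowerSeries.coeff m B (PowerSeries.coeff n A h) : Ec d → Ec d) x‖ ≤ D * s ^ (k - n)) := by
      intro n
      by_cases hnk : n < k
      · obtain ⟨D, hD, hD'⟩ := hV.expand (PowerSeries.coeff n A h) (k - n) (by omega) (by omega)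
        exact ⟨D, hD, fun _ => hD'⟩
      · exact ⟨0, le_rfl, fun h => absurd h hnk⟩
    choose D hD hD' using hn
    refine ⟨C + ∑ n ∈ Finset.range k, D n,
      add_nonneg hC (Finset.sum_nonneg fun n _ => hD n), fun s hs x => ?_⟩
    have key : ∑ n ∈ Finset.range k, s ^ n • (PowerSeries.coeff n (B * A) h : Ec d → Ec d) x =
        ∑ n ∈ Finset.range k, s ^ n • ∑ m ∈ Finset.range (k - n), s ^ m •
          (PowerSeries.coeff m B (PowerSeries.coeff n A h) : Ec d → Ec d) x := by
      simp_rw [Finset.smul_sum, smul_smul, ← pow_add]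
      rw [← Finset.sum_range_diag_flip k (fun n m => s ^ (n + m) •
        (PowerSeries.coeff m B (PowerSeries.coeff n A h) : Ec d → Ec d) x)]
      refine Finset.sum_congr rfl fun p _ => ?_
      rw [PowerSeries.coeff_mul, Finset.Nat.sum_antidiagonal_eq_sum_range_succ_mk,
        ← Finset.sum_range_reflect, LinearMap.sum_apply]
      simp only [Submodule.coe_sum, Finset.sum_apply, Finset.smul_sum]
      refine Finset.sum_congr rfl fun i hi => ?_
      have hi' : i ≤ p := by simpa [Nat.lt_succ_iff] using hi
      have e1 : p + 1 - 1 - i = p - i := by omega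
      have e2 : p - (p - i) = i := by omega
      have e3 : i + (p - i) = p := by omega
      simp only [e1, e2, e3]
      rfl
    rw [key]
    have split : (h : Ec d → Ec d) (W s (V s x)) - ∑ n ∈ Finset.range k, s ^ n •
        ∑ m ∈ Finset.range (k - n), s ^ m •
          (PowerSeries.coeff m B (PowerSeries.coeff n A h) : Ec d → Ec d) x =
        ((h : Ec d → Ec d) (W s (V s x)) - ∑ n ∈ Finset.range k, s ^ n •
          (PowerSeries.coeff n A h : Ec d → Ec d) (V s x)) +
        ∑ n ∈ Finset.range k, s ^ n • ((PowerSeries.coeff n A h : Ec d → Ec d) (V s x) -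
          ∑ m ∈ Finset.range (k - n), s ^ m •
          (PowerSeries.coeff m B (PowerSeries.coeff n A h) : Ec d → Ec d) x) := by
      simp_rw [smul_sub, Finset.sum_sub_distrib]
      abel
    rw [split, add_mul, Finset.sum_mul]
    refine (norm_add_le _ _).trans (add_le_add (hC' s hs _) ?_)
    refine (norm_sum_le _ _).trans (Finset.sum_le_sum fun n hn => ?_)
    have hn' := Finset.mem_range.1 hn
    rw [norm_smul, norm_pow, Real.norm_of_nonneg hs.1.le]
    calc _ ≤ s ^ n * (D n * s ^ (k - n)) := by
          have := hs.1.le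
          gcongr
          exact hD' n hn' s hs x
      _ = D n * s ^ k := by
          rw [mul_left_comm, ← pow_add, Nat.add_sub_cancel' hn'.le]
  cost := by
    obtain ⟨C, s₁, hC, hs₁, h⟩ := hW.cost
    obtain ⟨C', s₂, hC', hs₂, h'⟩ := hV.cost
    obtain ⟨s₃, hs₃, -, h₃⟩ := hV.exists_antilipschitz
    obtain ⟨s₄, hs₄, -, h₄⟩ := hW.exists_antilipschitz
    refine ⟨compConst d * C + C', min (min s₁ s₂) (min s₃ s₄),
      add_nonneg (mul_nonneg compConst_nonneg hC) hC', by positivity,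
      fun s hs u hu e g he he0 hg => ?_⟩
    have hle := hs.2
    simp only [le_min_iff] at hle
    have hVs := h₃ s ⟨hs.1, hle.2.1⟩
    have hWs := h₄ s ⟨hs.1, hle.2.2⟩
    have b1 := (h s ⟨hs.1, hle.1.1⟩ u hu e g he he0 hg).comp hVs.1 hVs.2.1
    have b2 := h' s ⟨hs.1, hle.1.2⟩ u hu e g he he0 hg
    have b3 := b1.add b2
    simp only [sub_add_sub_cancel] at b3
    exact b3.mono (by ring_nf; rfl)

/-! ### Approximate flows -/

theorem hasDerivAt_sum_pow_smul {F : Type*} [NormedAddCommGroup F] [NormedSpace ℝ F]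
    (v : ℕ → F) (M : ℕ) (s : ℝ) :
    HasDerivAt (fun s : ℝ => ∑ n ∈ Finset.range (M + 1), s ^ n • ((n.factorial : ℝ)⁻¹ • v n))
      (∑ n ∈ Finset.range M, s ^ n • ((n.factorial : ℝ)⁻¹ • v (n + 1))) s := by
  induction M with
  | zero => simpa using hasDerivAt_const s (v 0)
  | succ M ih =>
    simp_rw [Finset.sum_range_succ _ (M + 1)]
    rw [Finset.sum_range_succ _ M]
    refine ih.add ?_
    have h := (hasDerivAt_pow (M + 1) s).smul_const (((M + 1).factorial : ℝ)⁻¹ • v (M + 1))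
    convert h using 1
    rw [smul_smul, smul_smul, Nat.factorial_succ]
    congr 1
    push_cast
    have : (M.factorial : ℝ) ≠ 0 := by positivity
    field_simp

theorem slowMaps.exists_lipschitz (h : slowMaps d) : ∃ L : ℝ, 0 ≤ L ∧
    ∀ x y, ‖(h : Ec d → Ec d) x - (h : Ec d → Ec d) y‖ ≤ L * ‖x - y‖ := by
  obtain ⟨L, hL, hL'⟩ := h.2.2.exists_bound
  exact ⟨L, hL, fun x y => Convex.norm_image_sub_le_of_norm_fderiv_le (𝕜 := ℝ) (s := Set.univ)
    (fun x _ => slowMaps.differentiable h x) (fun x _ => hL' x) convex_univ trivial trivial⟩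

section Flow

variable (a : Ec d → Ec d) (ha : BddSmooth a)

/-- The formal exponential series of a vector field. -/
def flowSeries : PowerSeries (Module.End ℝ (slowMaps d)) :=
  PowerSeries.mk fun n => (n.factorial : ℝ)⁻¹ • vfOp a ha ^ n

/-- The Taylor polynomial of degree `M` of the flow of a vector field. -/
def flowMap (M : ℕ) (s : ℝ) (x : Ec d) : Ec d :=
  ∑ n ∈ Finset.range (M + 1), s ^ n •
    ((n.factorial : ℝ)⁻¹ • ((vfOp a ha ^ n) (slowId d) : Ec d → Ec d) x)

/-- The time derivative of `flowMap`. -/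
def flowVel (M : ℕ) (s : ℝ) (x : Ec d) : Ec d :=
  ∑ n ∈ Finset.range M, s ^ n •
    ((n.factorial : ℝ)⁻¹ • ((vfOp a ha ^ (n + 1)) (slowId d) : Ec d → Ec d) x)

theorem hasDerivAt_flowMap (M : ℕ) (s : ℝ) (x : Ec d) :
    HasDerivAt (fun s => flowMap a ha M s x) (flowVel a ha M s x) s :=
  hasDerivAt_sum_pow_smul (fun n => ((vfOp a ha ^ n) (slowId d) : Ec d → Ec d) x) M s

theorem flowMap_zero (M : ℕ) (x : Ec d) : flowMap a ha M 0 x = x := by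
  rw [flowMap, Finset.sum_range_succ']
  simp [slowId]

theorem bddSmooth_vfOp_pow_succ (n : ℕ) (h : slowMaps d) :
    BddSmooth ((vfOp a ha ^ (n + 1)) h : Ec d → Ec d) := by
  rw [pow_succ']
  exact bddSmooth_vfOp a ha _

theorem continuous_flowMap (M : ℕ) : Continuous (fun p : ℝ × Ec d => flowMap a ha M p.1 p.2) := by
  refine continuous_finsetSum _ fun n _ => ?_
  have := (slowMaps.differentiable ((vfOp a ha ^ n) (slowId d))).continuous
  fun_prop

theorem continuous_flowVel (M : ℕ) : Continuous (fun p : ℝ × Ec d => flowVel a ha M p.1 p.2) := by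
  refine continuous_finsetSum _ fun n _ => ?_
  have := (slowMaps.differentiable ((vfOp a ha ^ (n + 1)) (slowId d))).continuous
  fun_prop

theorem exists_norm_sum_Ico_le (f : ℕ → Ec d → Ec d) (hf : ∀ n, BddSmooth (f n)) (k M : ℕ) :
    ∃ C : ℝ, 0 ≤ C ∧ ∀ s ∈ Set.Icc (0 : ℝ) 1, ∀ x,
      ‖∑ n ∈ Finset.Ico k M, s ^ n • f n x‖ ≤ C * s ^ k := by
  choose C hC hC' using fun n => (hf n).exists_bound
  refine ⟨∑ n ∈ Finset.Ico k M, C n, Finset.sum_nonneg fun n _ => hC n, fun s hs x => ?_⟩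
  rw [Finset.sum_mul]
  refine (norm_sum_le _ _).trans (Finset.sum_le_sum fun n hn => ?_)
  rw [norm_smul, norm_pow, Real.norm_of_nonneg hs.1, mul_comm]
  have h1 := hs.1
  gcongr ?_ * ?_
  · exact hC n
  · exact hC' n x
  · exact pow_le_pow_of_le_one hs.1 hs.2 (Finset.mem_Ico.1 hn).1

theorem flowMap_sub (M : ℕ) (s : ℝ) (x : Ec d) : flowMap a ha M s x - x =
    ∑ n ∈ Finset.range M, s ^ (n + 1) •
      (((n + 1).factorial : ℝ)⁻¹ • ((vfOp a ha ^ (n + 1)) (slowId d) : Ec d → Ec d) x) := by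
  rw [flowMap, Finset.sum_range_succ']
  simp [slowId]

theorem exists_norm_flowMap_sub_le (M : ℕ) : ∃ C : ℝ, 0 ≤ C ∧ ∀ s ∈ Set.Icc (0 : ℝ) 1, ∀ x,
    ‖flowMap a ha M s x - x‖ ≤ C * s := by
  obtain ⟨C, hC, h⟩ := exists_norm_sum_Ico_le
    (fun n x => ((n + 1).factorial : ℝ)⁻¹ • ((vfOp a ha ^ (n + 1)) (slowId d) : Ec d → Ec d) x)
    (fun n => (bddSmooth_vfOp_pow_succ a ha n (slowId d)).smul _) 0 M
  refine ⟨C, hC, fun s hs x => ?_⟩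
  have h1 := h s hs x
  have : flowMap a ha M s x - x = s • ∑ n ∈ Finset.Ico 0 M, s ^ n •
      (((n + 1).factorial : ℝ)⁻¹ • ((vfOp a ha ^ (n + 1)) (slowId d) : Ec d → Ec d) x) := by
    rw [flowMap_sub, Finset.smul_sum, Finset.range_eq_Ico]
    simp_rw [pow_succ' s, mul_smul]
  rw [this, norm_smul, Real.norm_of_nonneg hs.1, mul_comm]
  gcongr
  · exact hs.1
  · simpa using h1

theorem coeff_flowSeries_apply (n : ℕ) (h : slowMaps d) (x : Ec d) :
    (PowerSeries.coeff n (flowSeries a ha) h : Ec d → Ec d) x =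
      (n.factorial : ℝ)⁻¹ • ((vfOp a ha ^ n) h : Ec d → Ec d) x := by
  rw [flowSeries, PowerSeries.coeff_mk]
  rfl

theorem flowMap_expand (M k : ℕ) (hk : 1 ≤ k) : k ≤ M + 1 → ∀ h : slowMaps d,
    ∃ C : ℝ, 0 ≤ C ∧ ∀ s ∈ Set.Icc (0 : ℝ) 1, ∀ x, ‖(h : Ec d → Ec d) (flowMap a ha M s x) -
      ∑ n ∈ Finset.range k, s ^ n •
        ((n.factorial : ℝ)⁻¹ • ((vfOp a ha ^ n) h : Ec d → Ec d) x)‖ ≤ C * s ^ k := by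
  induction k, hk using Nat.le_induction with
  | base =>
    intro _ h
    obtain ⟨L, hL, hL'⟩ := slowMaps.exists_lipschitz h
    obtain ⟨C, hC, hC'⟩ := exists_norm_flowMap_sub_le a ha M
    refine ⟨L * C, mul_nonneg hL hC, fun s hs x => ?_⟩
    have := (hL' (flowMap a ha M s x) x).trans (mul_le_mul_of_nonneg_left (hC' s hs x) hL)
    simpa [mul_assoc] using this
  | succ k hk ih =>
    intro hkM h
    obtain ⟨C₁, hC₁, h₁⟩ := ih (by omega) (vfOp a ha h)
    obtain ⟨C₂, hC₂, h₂⟩ := ih (by omega) (vfOp a ha (slowId d))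
    obtain ⟨C₃, hC₃, h₃⟩ := exists_norm_sum_Ico_le
      (fun n x => (n.factorial : ℝ)⁻¹ • ((vfOp a ha ^ (n + 1)) (slowId d) : Ec d → Ec d) x)
      (fun n => (bddSmooth_vfOp_pow_succ a ha n (slowId d)).smul _) k M
    obtain ⟨L, hL, hL'⟩ := h.2.2.exists_bound
    refine ⟨L * (C₃ + C₂) + C₁, by positivity, fun s hs x => ?_⟩
    set ψ : ℝ → Ec d := fun s => (h : Ec d → Ec d) (flowMap a ha M s x) -
      ∑ n ∈ Finset.range (k + 1), s ^ n •
        ((n.factorial : ℝ)⁻¹ • ((vfOp a ha ^ n) h : Ec d → Ec d) x) with hψ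
    have hd : ∀ σ, HasDerivAt ψ (fderiv ℝ (h : Ec d → Ec d) (flowMap a ha M σ x)
        (flowVel a ha M σ x) - ∑ n ∈ Finset.range k, σ ^ n •
        ((n.factorial : ℝ)⁻¹ • ((vfOp a ha ^ (n + 1)) h : Ec d → Ec d) x)) σ := fun σ =>
      ((slowMaps.differentiable h _).hasFDerivAt.comp_hasDerivAt σ
        (hasDerivAt_flowMap a ha M σ x)).sub (hasDerivAt_sum_pow_smul
        (fun n => ((vfOp a ha ^ n) h : Ec d → Ec d) x) k σ)
    have h0 : ψ 0 = 0 := by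
      simp only [hψ, flowMap_zero]
      rw [Finset.sum_range_succ']
      simp
    have hbd : ∀ σ ∈ Set.Ico 0 s, ‖fderiv ℝ (h : Ec d → Ec d) (flowMap a ha M σ x)
        (flowVel a ha M σ x) - ∑ n ∈ Finset.range k, σ ^ n •
        ((n.factorial : ℝ)⁻¹ • ((vfOp a ha ^ (n + 1)) h : Ec d → Ec d) x)‖ ≤
        (L * (C₃ + C₂) + C₁) * s ^ k := by
      intro σ hσ
      have hσ1 : σ ∈ Set.Icc (0 : ℝ) 1 := ⟨hσ.1, hσ.2.le.trans hs.2⟩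
      have e1 := h₁ σ hσ1 x
      have e2 := h₂ σ hσ1 x
      have e3 := h₃ σ hσ1 x
      rw [vfOp_slowId] at e2
      simp only [← Module.End.mul_apply, ← pow_succ] at e1 e2
      have hsplit : flowVel a ha M σ x = ∑ n ∈ Finset.range k, σ ^ n •
          ((n.factorial : ℝ)⁻¹ • ((vfOp a ha ^ (n + 1)) (slowId d) : Ec d → Ec d) x) +
          ∑ n ∈ Finset.Ico k M, σ ^ n •
          ((n.factorial : ℝ)⁻¹ • ((vfOp a ha ^ (n + 1)) (slowId d) : Ec d → Ec d) x) :=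
        (Finset.sum_range_add_sum_Ico _ (by omega)).symm
      have e4 : ‖flowVel a ha M σ x - a (flowMap a ha M σ x)‖ ≤ (C₃ + C₂) * σ ^ k := by
        rw [hsplit, add_comm, add_sub_assoc, add_mul]
        refine (norm_add_le _ _).trans (add_le_add e3 ?_)
        rw [norm_sub_rev]
        exact e2
      have e5 : fderiv ℝ (h : Ec d → Ec d) (flowMap a ha M σ x) (flowVel a ha M σ x) -
          ∑ n ∈ Finset.range k, σ ^ n •
            ((n.factorial : ℝ)⁻¹ • ((vfOp a ha ^ (n + 1)) h : Ec d → Ec d) x) =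
          fderiv ℝ (h : Ec d → Ec d) (flowMap a ha M σ x)
            (flowVel a ha M σ x - a (flowMap a ha M σ x)) +
          ((vfOp a ha h : Ec d → Ec d) (flowMap a ha M σ x) - ∑ n ∈ Finset.range k, σ ^ n •
            ((n.factorial : ℝ)⁻¹ • ((vfOp a ha ^ (n + 1)) h : Ec d → Ec d) x)) := by
        rw [map_sub, vfOp_apply]
        abel
      rw [e5]
      have hpow : σ ^ k ≤ s ^ k := pow_le_pow_left₀ hσ.1 hσ.2.le k
      calc _ ≤ L * ((C₃ + C₂) * σ ^ k) + C₁ * σ ^ k := by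
            refine (norm_add_le _ _).trans (add_le_add ?_ e1)
            refine (ContinuousLinearMap.le_opNorm _ _).trans ?_
            gcongr
            exact hL' _
        _ = (L * (C₃ + C₂) + C₁) * σ ^ k := by ring
        _ ≤ _ := by gcongr
    have := norm_image_sub_le_of_norm_deriv_le_segment' (f := ψ) (a := 0) (b := s)
      (fun σ _ => (hd σ).hasDerivWithinAt) hbd s ⟨hs.1, le_rfl⟩
    rw [h0, sub_zero, sub_zero, mul_assoc, ← pow_succ] at this
    exact this

theorem isTransport_flowMap {N : ℕ} {X : Fin N → Ec d → Ec d} {M : ℕ} (hM : 1 ≤ M)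
    (haX : ∀ u : Ec d → ℂ, ContDiff ℝ (⊤ : ℕ∞) u → ∀ e, (∀ i, L2le (vfApply (X i) u) e) →
      L2le (vfApply a u) e) :
    IsTransport X M (flowMap a ha M) (flowSeries a ha) := by
  have hlip : ∃ C : ℝ, 0 ≤ C ∧ ∀ s ∈ Set.Ioc (0 : ℝ) 1, ∀ x y,
      ‖(flowMap a ha M s x - x) - (flowMap a ha M s y - y)‖ ≤ C * s * ‖x - y‖ := by
    choose L hL hL' using fun n => slowMaps.exists_lipschitz
      (((n + 1).factorial : ℝ)⁻¹ • (vfOp a ha ^ (n + 1)) (slowId d))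
    refine ⟨∑ n ∈ Finset.range M, L n, Finset.sum_nonneg fun n _ => hL n, fun s hs x y => ?_⟩
    rw [flowMap_sub, flowMap_sub, ← Finset.sum_sub_distrib, Finset.sum_mul, Finset.sum_mul]
    refine (norm_sum_le _ _).trans (Finset.sum_le_sum fun n _ => ?_)
    rw [← smul_sub, norm_smul, norm_pow, Real.norm_of_nonneg hs.1.le]
    calc _ ≤ s ^ 1 * (L n * ‖x - y‖) := by
          have h1 : s ^ (n + 1) ≤ s ^ 1 := pow_le_pow_of_le_one hs.1.le hs.2 (by omega)
          gcongr
          · exact pow_nonneg hs.1.le _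
          · exact hL' n x y
      _ = _ := by ring
  have hexp : ∀ (h : slowMaps d) (k : ℕ), 1 ≤ k → k ≤ M + 1 → ∃ C : ℝ, 0 ≤ C ∧
    ∀ s ∈ Set.Ioc (0 : ℝ) 1, ∀ x, ‖(h : Ec d → Ec d) (flowMap a ha M s x) -
      ∑ n ∈ Finset.range k, s ^ n •
        (PowerSeries.coeff n (flowSeries a ha) h : Ec d → Ec d) x‖ ≤ C * s ^ k := by
    intro h k hk hkM
    obtain ⟨C, hC, hC'⟩ := flowMap_expand a ha M k hk hkM h
    refine ⟨C, hC, fun s hs x => ?_⟩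
    simp only [coeff_flowSeries_apply]
    exact hC' s ⟨hs.1.le, hs.2⟩ x
  refine ⟨hlip, hexp, ?_⟩
  obtain ⟨L, hL, hL'⟩ := hlip
  obtain ⟨C, hC, hC'⟩ := flowMap_expand a ha M M hM (by omega) (vfOp a ha (slowId d))
  have hvel : ∀ s ∈ Set.Icc (0 : ℝ) 1, ∀ x,
      ‖flowVel a ha M s x - a (flowMap a ha M s x)‖ ≤ C * s ^ M := by
    intro s hs x
    have := hC' s hs x
    rw [vfOp_slowId, norm_sub_rev] at this
    simp only [← Module.End.mul_apply, ← pow_succ] at this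
    exact this
  set s₀ : ℝ := min 1 (1 / (2 * (L + 1))) with hs₀
  have hc0 := compConst_nonneg (d := d)
  refine ⟨compConst d * (1 + C), s₀, by positivity, by positivity,
    fun s hs u hu e g he he0 hg => ?_⟩
  have hcont : ∀ σ, Continuous (flowMap a ha M σ) := fun σ =>
    (continuous_flowMap a ha M).comp (Continuous.prodMk_right σ)
  have hanti : ∀ σ ∈ Set.Ioc 0 s₀, AntilipschitzWith 2 (flowMap a ha M σ) := by
    intro σ hσ
    have h2 : L * σ ≤ 1 / 2 := by
      have h1 : σ ≤ 1 / (2 * (L + 1)) := hσ.2.trans (min_le_right _ _)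
      rw [le_div_iff₀ (by positivity)] at h1
      nlinarith [hσ.1]
    exact antilipschitzWith_of_lipschitzWith_sub_id h2
      (hL' σ ⟨hσ.1, hσ.2.trans (min_le_left _ _)⟩)
  have hdu : Continuous (fderiv ℝ u) := hu.continuous_fderiv (by simp)
  have hgc : Continuous (Function.uncurry fun (σ : ℝ) (x : Ec d) =>
      fderiv ℝ u (flowMap a ha M σ x) (flowVel a ha M σ x)) :=
    (hdu.comp (continuous_flowMap a ha M)).clm_apply (continuous_flowVel a ha M)
  have hs1 : s ≤ 1 := hs.2.trans (min_le_left _ _)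
  have key : L2le (fun x => u (flowMap a ha M s x) - u x)
      (s * (compConst d * e + (C * s ^ M) * (compConst d * g))) := by
    refine L2le.of_integral (g := fun (σ : ℝ) (x : Ec d) =>
      fderiv ℝ u (flowMap a ha M σ x) (flowVel a ha M σ x)) hs.1.le
      (aestronglyMeasurable_comp_sub hu.continuous (hcont s)) hgc ?_ ?_ ?_
    · intro σ hσ
      have hσ0 : σ ∈ Set.Ioc 0 s₀ := ⟨hσ.1, hσ.2.trans hs.2⟩
      have b1 := (haX u hu e he).comp (hcont σ) (hanti σ hσ0)
      have b2 := hg.comp (hcont σ) (hanti σ hσ0)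
      have hac : Continuous a := ha.1.continuous
      have b3 : L2le (fun x => fderiv ℝ u (flowMap a ha M σ x)
          (flowVel a ha M σ x - a (flowMap a ha M σ x))) ((C * s ^ M) * (compConst d * g)) := by
        refine b2.of_le_mul (mul_nonneg hC (pow_nonneg hs.1.le _)) ?_ fun x => ?_
        · exact ((hdu.comp (hcont σ)).clm_apply
            (((continuous_flowVel a ha M).comp (Continuous.prodMk_right σ)).sub
              (hac.comp (hcont σ)))).aestronglyMeasurable
        · refine (ContinuousLinearMap.le_opNorm _ _).trans ?_
          rw [mul_comm]
          gcongr
          refine (hvel σ ⟨hσ.1.le, hσ.2.trans hs1⟩ x).trans ?_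
          have := hσ.1.le
          gcongr
          exact hσ.2
      have b4 := b1.add b3
      have e : (fun x => vfApply a u (flowMap a ha M σ x) + fderiv ℝ u (flowMap a ha M σ x)
          (flowVel a ha M σ x - a (flowMap a ha M σ x))) = fun x =>
          fderiv ℝ u (flowMap a ha M σ x) (flowVel a ha M σ x) := by
        ext1 x
        simp [vfApply]
      rwa [e] at b4
    · have := hg.2.1
      have := hs.1
      positivity
    · intro x
      have hderiv : ∀ σ ∈ Set.uIcc 0 s, HasDerivAt (fun σ => u (flowMap a ha M σ x))
          (fderiv ℝ u (flowMap a ha M σ x) (flowVel a ha M σ x)) σ := fun σ _ =>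
        (hu.differentiable (by simp) _).hasFDerivAt.comp_hasDerivAt σ
          (hasDerivAt_flowMap a ha M σ x)
      have hci : Continuous fun σ => fderiv ℝ u (flowMap a ha M σ x) (flowVel a ha M σ x) :=
        hgc.comp (Continuous.prodMk_left x)
      have := intervalIntegral.integral_eq_sub_of_hasDerivAt hderiv (hci.intervalIntegrable _ _)
      rw [flowMap_zero] at this
      rw [← this]
      exact intervalIntegral.norm_integral_le_integral_norm hs.1.le
  refine key.mono ?_
  have h1 := hs.1
  have h2 := hg.2.1
  have : 0 ≤ compConst d * (s * e) * C := by positivity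
  have : 0 ≤ compConst d * (s ^ (M + 1) * g) := by positivity
  calc _ = compConst d * (s * e) + compConst d * C * (s ^ (M + 1) * g) := by ring
    _ ≤ _ := by nlinarith

end Flow

theorem sum_antidiagonal_exp_mul_exp_neg {R : Type*} [Ring R] [Algebra ℝ R] (T : R) (n : ℕ) :
    ∑ p ∈ HasAntidiagonal.antidiagonal n,
      ((p.1.factorial : ℝ)⁻¹ • T ^ p.1) * ((p.2.factorial : ℝ)⁻¹ • (-T) ^ p.2) =
      if n = 0 then 1 else 0 := by
  have h := (Commute.neg_right (Commute.refl T)).add_pow' n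
  rw [add_neg_cancel] at h
  have h2 : ∑ p ∈ HasAntidiagonal.antidiagonal n,
      ((p.1.factorial : ℝ)⁻¹ • T ^ p.1) * ((p.2.factorial : ℝ)⁻¹ • (-T) ^ p.2) =
      (n.factorial : ℝ)⁻¹ • ∑ p ∈ HasAntidiagonal.antidiagonal n, n.choose p.1 • (T ^ p.1 * (-T) ^ p.2) := by
    rw [Finset.smul_sum]
    refine Finset.sum_congr rfl fun p hp => ?_
    rw [HasAntidiagonal.mem_antidiagonal] at hp
    rw [smul_mul_smul_comm, ← Nat.cast_smul_eq_nsmul ℝ, smul_smul]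
    congr 1
    have h3 := Nat.choose_mul_factorial_mul_factorial (n := p.1 + p.2) (Nat.le_add_right p.1 p.2)
    rw [Nat.add_sub_cancel_left] at h3
    rw [← hp, ← h3]
    push_cast
    have : ((p.1 + p.2).choose p.1 : ℝ) ≠ 0 := by
      exact_mod_cast (Nat.choose_pos (Nat.le_add_right _ _)).ne'
    field_simp
  rw [h2, ← h]
  split_ifs with hn
  · subst hn; simp
  · simp [hn]

theorem flowSeries_mul_neg (a : Ec d → Ec d) (ha : BddSmooth a) :
    flowSeries a ha * flowSeries (fun x => -a x) ha.neg = 1 := by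
  ext1 n
  rw [PowerSeries.coeff_mul, PowerSeries.coeff_one]
  simp only [flowSeries, PowerSeries.coeff_mk, vfOp_neg a ha]
  exact sum_antidiagonal_exp_mul_exp_neg (vfOp a ha) n

/-! ### Group commutators of approximate flows -/

theorem powerSeries_group_commutator {R : Type*} [Semiring R] {A B U V P Q D : PowerSeries R}
    {m : ℕ} (hm : 1 ≤ m) (hA : A = 1 + PowerSeries.X * P) (hU : U = 1 + PowerSeries.X ^ m * Q)
    (hAB : A * B = 1) (hUV : U * V = 1) (hD : P * Q = Q * P + D) :
    A * U * B * V = 1 + PowerSeries.X ^ (m + 1) * (D * B * V) ∧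
    PowerSeries.constantCoeff (D * B * V) = PowerSeries.constantCoeff D := by
  have h1 : A * U = U * A + PowerSeries.X ^ (m + 1) * D := by
    have e1 : PowerSeries.X * P * (PowerSeries.X ^ m * Q) = PowerSeries.X ^ (m + 1) * (P * Q) := by
      rw [mul_assoc, ← mul_assoc P, ← PowerSeries.X_pow_mul, mul_assoc, ← mul_assoc, ← pow_succ']
    have e2 : PowerSeries.X ^ m * Q * (PowerSeries.X * P) = PowerSeries.X ^ (m + 1) * (Q * P) := by
      rw [mul_assoc, ← mul_assoc Q, ← PowerSeries.X_mul, mul_assoc, ← mul_assoc, ← pow_succ]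
    rw [hA, hU, add_mul, mul_add, mul_add, add_mul, mul_add, mul_add, e1, e2, hD, mul_add]
    simp only [one_mul, mul_one]
    abel
  have hcA : PowerSeries.constantCoeff A = 1 := by simp [hA]
  have hcU : PowerSeries.constantCoeff U = 1 := by
    simp [hU, show m ≠ 0 by omega]
  have hcB : PowerSeries.constantCoeff B = 1 := by
    have := congrArg PowerSeries.constantCoeff hAB
    simpa [hcA] using this
  have hcV : PowerSeries.constantCoeff V = 1 := by
    have := congrArg PowerSeries.constantCoeff hUV
    simpa [hcU] using this
  constructor
  · rw [h1, add_mul, add_mul, mul_assoc U, hAB, mul_one, hUV]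
    simp only [mul_assoc]
  · simp [hcB, hcV]

theorem exists_powerSeries_commutator (P Q : PowerSeries (Module.End ℝ (slowMaps d))) :
    ∃ D : PowerSeries (Module.End ℝ (slowMaps d)), P * Q = Q * P + D ∧
      PowerSeries.constantCoeff D = PowerSeries.constantCoeff P * PowerSeries.constantCoeff Q -
        PowerSeries.constantCoeff Q * PowerSeries.constantCoeff P := by
  refine ⟨PowerSeries.mk fun n => PowerSeries.coeff n (P * Q) - PowerSeries.coeff n (Q * P), ?_, ?_⟩
  · ext1 n
    rw [map_add, PowerSeries.coeff_mk]
    ext1 h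
    simp
  · rw [← PowerSeries.coeff_zero_eq_constantCoeff_apply, PowerSeries.coeff_mk]
    simp

theorem mul_four_inverse {G : Type*} [Monoid G] {A B U V A' B' U' V' : G} (hA : A * A' = 1)
    (hB : B * B' = 1) (hU : U * U' = 1) (hV : V * V' = 1) :
    A * U * B * V * (V' * B' * U' * A') = 1 := by
  calc _ = A * (U * (B * (V * V') * B') * U') * A' := by simp only [mul_assoc]
    _ = 1 := by rw [hV, mul_one, hB, mul_one, hU, mul_one, hA]

theorem flowSeries_neg_mul (a : Ec d → Ec d) (ha : BddSmooth a) :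
    flowSeries (fun x => -a x) ha.neg * flowSeries a ha = 1 := by
  have h := flowSeries_mul_neg _ ha.neg
  have e : (fun x => - -a x) = a := by funext x; simp
  rwa [show flowSeries (fun x => - -a x) ha.neg.neg = flowSeries a ha by congr 1] at h

/-- A transport family which is invertible at the level of formal series, and whose leading
term, at the order `m`, is the vector field `a`. -/
def HasTransport {N : ℕ} (X : Fin N → Ec d → Ec d) (M m : ℕ) (a : Ec d → Ec d)
    (ha : BddSmooth a) : Prop :=
  ∃ (W W' : ℝ → Ec d → Ec d) (A A' Q : PowerSeries (Module.End ℝ (slowMaps d))),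
    IsTransport X M W A ∧ IsTransport X M W' A' ∧ A * A' = 1 ∧ A' * A = 1 ∧
    A = 1 + PowerSeries.X ^ m * Q ∧ PowerSeries.constantCoeff Q = vfOp a ha

theorem hasTransport_field {N : ℕ} {X : Fin N → Ec d → Ec d} (hX : ∀ i, BddSmooth (X i)) {M : ℕ}
    (hM : 1 ≤ M) (i : Fin N) : HasTransport X M 1 (X i) (hX i) := by
  refine ⟨_, _, _, _, PowerSeries.mk fun n => PowerSeries.coeff (n + 1) (flowSeries (X i) (hX i)),
    isTransport_flowMap (X i) (hX i) hM fun u _ e he => he i,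
    isTransport_flowMap (fun x => -X i x) (hX i).neg hM fun u _ e he => ?_,
    flowSeries_mul_neg _ _, flowSeries_neg_mul _ _, ?_, ?_⟩
  · have : vfApply (fun x => -X i x) u = fun x => -vfApply (X i) u x := by
      ext1 x
      simp [vfApply]
    rw [this]
    exact (he i).of_norm_le (he i).1.neg fun x => by simp
  · conv_lhs => rw [PowerSeries.eq_X_mul_shift_add_const (flowSeries (X i) (hX i))]
    rw [add_comm, pow_one]
    congr 1
    simp [flowSeries]
  · simp [flowSeries]

theorem hasTransport_vfComm {N : ℕ} {X : Fin N → Ec d → Ec d} {M m : ℕ} (hm : 1 ≤ m)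
    {a b : Ec d → Ec d} {ha : BddSmooth a} {hb : BddSmooth b} (hta : HasTransport X M 1 a ha)
    (htb : HasTransport X M m b hb) : HasTransport X M (m + 1) (vfComm a b) (ha.vfComm hb) := by
  obtain ⟨W₁, V₁, A, B, P, hW₁, hV₁, hAB, hBA, hA, hP⟩ := hta
  obtain ⟨W₂, V₂, U, V, Q, hW₂, hV₂, hUV, hVU, hU, hQ⟩ := htb
  rw [pow_one] at hA
  obtain ⟨D, hD, hD0⟩ := exists_powerSeries_commutator P Q
  have h := powerSeries_group_commutator hm hA hU hAB hUV hD
  have h2 := vfOp_vfComm a b ha hb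
  rw [← hP, ← hQ] at h2
  refine ⟨_, _, A * U * B * V, U * A * V * B, _, hV₂.comp (hV₁.comp (hW₂.comp hW₁)),
    hV₁.comp (hV₂.comp (hW₁.comp hW₂)), mul_four_inverse hAB hBA hUV hVU,
    mul_four_inverse hUV hVU hAB hBA, h.1, h.2.trans (hD0.trans h2.symm)⟩

theorem hasTransport_multiComm {N : ℕ} {X : Fin N → Ec d → Ec d}
    (hX : ∀ i, BddSmooth (X i)) {M : ℕ} (hM : 1 ≤ M) : ∀ l : List (Fin N), l ≠ [] →
    HasTransport X M l.length (multiComm X l) (BddSmooth.multiComm hX l)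
  | [], h => absurd rfl h
  | [i], _ => hasTransport_field hX hM i
  | i :: j :: l, _ => hasTransport_vfComm (by simp) (hasTransport_field hX hM i)
      (hasTransport_multiComm hX hM (j :: l) (by simp))

/-! ### Estimates along commutators -/

theorem hasDerivAt_taylor {u : Ec d → ℂ} (hu : ContDiff ℝ (⊤ : ℕ∞) u) (x w : Ec d) (σ : ℝ) :
    HasDerivAt (fun σ : ℝ => u (x + σ • w) + (1 - σ) • fderiv ℝ u (x + σ • w) w)
      ((1 - σ) • fderiv ℝ (fderiv ℝ u) (x + σ • w) w w) σ := by
  have hu' : ContDiff ℝ (⊤ : ℕ∞) (fderiv ℝ u) := hu.fderiv_right (by simp)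
  have h0 : HasDerivAt (fun σ : ℝ => x + σ • w) w σ := by
    simpa using ((hasDerivAt_id σ).smul_const w).const_add x
  have h1 : HasDerivAt (fun σ : ℝ => u (x + σ • w)) (fderiv ℝ u (x + σ • w) w) σ :=
    (hu.differentiable (by simp) (x + σ • w)).hasFDerivAt.comp_hasDerivAt σ h0
  have h2 : HasDerivAt (fun σ : ℝ => fderiv ℝ u (x + σ • w))
      (fderiv ℝ (fderiv ℝ u) (x + σ • w) w) σ :=
    (hu'.differentiable (by simp) (x + σ • w)).hasFDerivAt.comp_hasDerivAt σ h0
  have h2' : HasDerivAt (fun σ : ℝ => fderiv ℝ u (x + σ • w) w)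
      (fderiv ℝ (fderiv ℝ u) (x + σ • w) w w) σ :=
    (ContinuousLinearMap.apply ℝ ℂ w).hasFDerivAt.comp_hasDerivAt σ h2
  have h3 : HasDerivAt (fun σ : ℝ => (1 - σ) • fderiv ℝ u (x + σ • w) w)
      ((1 - σ) • fderiv ℝ (fderiv ℝ u) (x + σ • w) w w + (-1 : ℝ) • fderiv ℝ u (x + σ • w) w) σ :=
    ((hasDerivAt_id σ).const_sub 1).smul h2'
  refine (h1.add h3).congr_deriv ?_
  rw [neg_one_smul]
  abel

theorem l2le_taylor_remainder {W : Ec d → Ec d} {δ q : ℝ}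
    (hW : ∀ x y, ‖(W x - x) - (W y - y)‖ ≤ 1 / 2 * ‖x - y‖) (hδ : ∀ x, ‖W x - x‖ ≤ δ)
    {u : Ec d → ℂ} (hu : ContDiff ℝ (⊤ : ℕ∞) u) (hq : L2le (fderiv ℝ (fderiv ℝ u)) q) :
    L2le (fun x => u (W x) - u x - fderiv ℝ u x (W x - x)) (δ ^ 2 * (compConst d * q)) := by
  have hWc := continuous_of_lipschitz_sub_id hW
  have hdu : Continuous (fderiv ℝ u) := hu.continuous_fderiv (by simp)
  have hu' : ContDiff ℝ (⊤ : ℕ∞) (fderiv ℝ u) := hu.fderiv_right (by simp)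
  have hddu : Continuous (fderiv ℝ (fderiv ℝ u)) := hu'.continuous_fderiv (by simp)
  have hq0 := hq.2.1
  have hc0 := compConst_nonneg (d := d)
  set G : ℝ → Ec d → ℂ := fun σ x => (1 - σ) •
    fderiv ℝ (fderiv ℝ u) (x + σ • (W x - x)) (W x - x) (W x - x) with hG
  have hGc : Continuous (Function.uncurry G) := by
    have h1 : Continuous fun p : ℝ × Ec d => W p.2 - p.2 := by fun_prop
    have h2 : Continuous fun p : ℝ × Ec d => fderiv ℝ (fderiv ℝ u) (p.2 + p.1 • (W p.2 - p.2)) :=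
      hddu.comp (by fun_prop)
    exact (continuous_const.sub continuous_fst).smul ((h2.clm_apply h1).clm_apply h1)
  have hm : AEStronglyMeasurable (fun x => u (W x) - u x - fderiv ℝ u x (W x - x)) volume :=
    (((hu.continuous.comp hWc).sub hu.continuous).sub
      (hdu.clm_apply (hWc.sub continuous_id))).aestronglyMeasurable
  have key := L2le.of_integral (g := G) (s := 1) (B := δ ^ 2 * (compConst d * q)) zero_le_one hm
    hGc ?_ (by positivity) ?_
  · simpa using key
  · intro σ hσ
    have hVc : Continuous fun x => x + σ • (W x - x) := by fun_prop
    have hV : AntilipschitzWith 2 fun x => x + σ • (W x - x) := by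
      refine antilipschitzWith_of_lipschitzWith_sub_id le_rfl fun x y => ?_
      rw [add_sub_cancel_left, add_sub_cancel_left, ← smul_sub, norm_smul,
        Real.norm_of_nonneg hσ.1.le]
      calc _ ≤ 1 * ‖(W x - x) - (W y - y)‖ := by gcongr; exact hσ.2
        _ ≤ _ := by rw [one_mul]; exact hW x y
    refine (hq.comp hVc hV).of_le_mul (by positivity)
      (hGc.comp (Continuous.prodMk_right σ)).aestronglyMeasurable fun x => ?_
    simp only [hG]
    rw [norm_smul]
    have h1 : ‖1 - σ‖ ≤ 1 := by
      rw [Real.norm_of_nonneg (by linarith [hσ.2])]; linarith [hσ.1]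
    calc _ ≤ 1 * (‖fderiv ℝ (fderiv ℝ u) (x + σ • (W x - x))‖ * δ * δ) := by
          gcongr
          refine (ContinuousLinearMap.le_opNorm₂ _ _ _).trans ?_
          have hδ0 : 0 ≤ δ := (norm_nonneg _).trans (hδ x)
          gcongr <;> exact hδ x
      _ = _ := by ring
  · intro x
    have hderiv : ∀ σ ∈ Set.uIcc (0 : ℝ) 1, HasDerivAt (fun σ : ℝ => u (x + σ • (W x - x)) +
        (1 - σ) • fderiv ℝ u (x + σ • (W x - x)) (W x - x)) (G σ x) σ := fun σ _ =>
      hasDerivAt_taylor hu x (W x - x) σ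
    have hci : Continuous fun σ => G σ x := hGc.comp (Continuous.prodMk_left x)
    have := intervalIntegral.integral_eq_sub_of_hasDerivAt hderiv (hci.intervalIntegrable _ _)
    simp only [one_smul, zero_smul, sub_self, sub_zero, add_zero, add_sub_cancel] at this
    rw [sub_sub, ← this]
    exact intervalIntegral.norm_integral_le_integral_norm zero_le_one

theorem HasTransport.exists_expand {N : ℕ} {X : Fin N → Ec d → Ec d} {M m : ℕ} (hm : 1 ≤ m)
    (hmM : m ≤ M) {a : Ec d → Ec d} {ha : BddSmooth a} {W : ℝ → Ec d → Ec d}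
    {A Q : PowerSeries (Module.End ℝ (slowMaps d))} (hW : IsTransport X M W A)
    (hA : A = 1 + PowerSeries.X ^ m * Q) (hQ : PowerSeries.constantCoeff Q = vfOp a ha) :
    ∃ C : ℝ, 0 ≤ C ∧ ∀ s ∈ Set.Ioc (0 : ℝ) 1, ∀ x,
      ‖W s x - x - s ^ m • a x‖ ≤ C * s ^ (m + 1) := by
  obtain ⟨C, hC, h⟩ := hW.expand (slowId d) (m + 1) (by omega) (by omega)
  refine ⟨C, hC, fun s hs x => ?_⟩
  have h1 := h s hs x
  have c0 : PowerSeries.coeff 0 A = 1 := by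
    simp [hA, show m ≠ 0 by omega]
  have cm : PowerSeries.coeff m A = vfOp a ha := by
    rw [hA, map_add, PowerSeries.coeff_X_pow_mul', PowerSeries.coeff_one, if_neg (by omega),
      if_pos le_rfl, Nat.sub_self, PowerSeries.coeff_zero_eq_constantCoeff_apply, hQ, zero_add]
  have h2 : ∑ n ∈ Finset.range (m + 1), s ^ n •
      (PowerSeries.coeff n A (slowId d) : Ec d → Ec d) x = x + s ^ m • a x := by
    rw [Finset.sum_range_succ, Finset.sum_eq_single_of_mem 0 (by simp; omega)]
    · rw [c0, cm, vfOp_slowId]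
      simp [slowId]
    · intro n hn hn0
      have := Finset.mem_range.1 hn
      simp only [hA, map_add, PowerSeries.coeff_X_pow_mul', PowerSeries.coeff_one]
      rw [if_neg hn0, if_neg (by omega)]
      simp
  rw [h2, ← sub_sub] at h1
  exact h1

theorem HasTransport.estimate {N : ℕ} {X : Fin N → Ec d → Ec d} {M m : ℕ} (hm : 1 ≤ m)
    (hmM : m ≤ M) {a : Ec d → Ec d} {ha : BddSmooth a} (h : HasTransport X M m a ha) :
    ∃ C s₀ : ℝ, 0 ≤ C ∧ 0 < s₀ ∧ ∀ s ∈ Set.Ioc (0 : ℝ) s₀, ∀ u : Ec d → ℂ,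
      ContDiff ℝ (⊤ : ℕ∞) u → ∀ e g q : ℝ, (∀ i, L2le (vfApply (X i) u) e) → 0 ≤ e →
      L2le (fderiv ℝ u) g → L2le (fderiv ℝ (fderiv ℝ u)) q →
      L2le (fun x => s ^ m • vfApply a u x) (C * (s * e + s ^ (m + 1) * g + s ^ (2 * m) * q)) := by
  obtain ⟨W, -, A, -, Q, hW, -, -, -, hA, hQ⟩ := h
  obtain ⟨C₁, hC₁, h₁⟩ := HasTransport.exists_expand hm hmM hW hA hQ
  obtain ⟨C₂, s₂, hC₂, hs₂, h₂⟩ := hW.cost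
  obtain ⟨s₃, hs₃, hs₃1, h₃⟩ := hW.exists_antilipschitz
  obtain ⟨K, hK, hK'⟩ := ha.exists_bound
  have hc0 := compConst_nonneg (d := d)
  refine ⟨C₂ + C₁ + (C₁ + K) ^ 2 * compConst d, min s₂ s₃, by positivity, by positivity,
    fun s hs u hu e g q he he0 hg hq => ?_⟩
  have hle := hs.2
  rw [le_min_iff] at hle
  have hs0 := hs.1
  have hs1 : s ≤ 1 := hle.2.trans hs₃1
  obtain ⟨hWc, -, hlip⟩ := h₃ s ⟨hs.1, hle.2⟩
  have hexp := h₁ s ⟨hs.1, hs1⟩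
  have hdu : Continuous (fderiv ℝ u) := hu.continuous_fderiv (by simp)
  have hac : Continuous a := ha.1.continuous
  have hg0 := hg.2.1
  have hq0 := hq.2.1
  have hδ : ∀ x, ‖W s x - x‖ ≤ (C₁ + K) * s ^ m := by
    intro x
    have : W s x - x = (W s x - x - s ^ m • a x) + s ^ m • a x := by abel
    rw [this, add_mul]
    refine (norm_add_le _ _).trans (add_le_add ((hexp x).trans ?_) ?_)
    · gcongr ?_ * ?_
      exact pow_le_pow_of_le_one hs0.le hs1 (by omega)
    · rw [norm_smul, norm_pow, Real.norm_of_nonneg hs0.le, mul_comm]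
      gcongr
      exact hK' x
  have b1 := h₂ s ⟨hs.1, hle.1⟩ u hu e g he he0 hg
  have b2 : L2le (fun x => fderiv ℝ u x (s ^ m • a x - (W s x - x))) ((C₁ * s ^ (m + 1)) * g) := by
    refine hg.of_le_mul (by positivity) ?_ fun x => ?_
    · exact (hdu.clm_apply (by fun_prop)).aestronglyMeasurable
    · refine (ContinuousLinearMap.le_opNorm _ _).trans ?_
      rw [mul_comm]
      gcongr
      rw [norm_sub_rev]
      exact hexp x
  have b3 := l2le_taylor_remainder hlip hδ hu hq
  have b3' : L2le (fun x => -(u (W s x) - u x - fderiv ℝ u x (W s x - x))) _ :=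
    b3.of_norm_le b3.1.neg fun x => by rw [norm_neg]
  have b4 := (b1.add b2).add b3'
  have e4 : (fun x => u (W s x) - u x + fderiv ℝ u x (s ^ m • a x - (W s x - x)) +
      -(u (W s x) - u x - fderiv ℝ u x (W s x - x))) = fun x => s ^ m • vfApply a u x := by
    ext1 x
    rw [map_sub, map_smul, vfApply]
    ring
  rw [e4] at b4
  refine b4.mono ?_
  have hp : s ^ (M + 1) * g ≤ s ^ (m + 1) * g := by
    gcongr ?_ * g
    exact pow_le_pow_of_le_one hs0.le hs1 (by omega)
  have e5 : ((C₁ + K) * s ^ m) ^ 2 * (compConst d * q) =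
      (C₁ + K) ^ 2 * compConst d * (s ^ (2 * m) * q) := by ring
  rw [e5]
  have p1 : 0 ≤ s * e := by positivity
  have p2 : 0 ≤ s ^ (m + 1) * g := by positivity
  have p3 : 0 ≤ s ^ (2 * m) * q := by positivity
  have p4 : 0 ≤ (C₁ + K) ^ 2 * compConst d := by positivity
  calc _ ≤ C₂ * (s * e + s ^ (m + 1) * g) + C₁ * (s ^ (m + 1) * g) +
        (C₁ + K) ^ 2 * compConst d * (s ^ (2 * m) * q) := by
        have : C₂ * (s * e + s ^ (M + 1) * g) ≤ C₂ * (s * e + s ^ (m + 1) * g) := by gcongr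
        linarith
    _ ≤ _ := by
        have := mul_nonneg hC₂ p3
        have := mul_nonneg hC₁ p3
        have := mul_nonneg hC₁ p1
        have := mul_nonneg p4 p1
        have := mul_nonneg p4 p2
        nlinarith

theorem multiComm_estimate {N : ℕ} {X : Fin N → Ec d → Ec d} (hX : ∀ i, BddSmooth (X i)) {r : ℕ}
    {l : List (Fin N)} (hl : l ≠ []) (hlr : l.length ≤ r) :
    ∃ C : ℝ, 0 ≤ C ∧ ∀ᶠ τ in nhdsWithin (0 : ℝ) (Set.Ioi 0), ∀ u : Ec d → ℂ,
      ContDiff ℝ (⊤ : ℕ∞) u → ∀ e g q : ℝ, (∀ i, L2le (vfApply (X i) u) e) → 0 ≤ e →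
      L2le (fderiv ℝ u) g → L2le (fderiv ℝ (fderiv ℝ u)) q →
      L2le (vfApply (multiComm X l) u)
        (C * (τ ^ (1 / (r : ℝ) - 1) * e + τ ^ (1 / (r : ℝ)) * g + τ * q)) := by
  have hm : 1 ≤ l.length := List.length_pos_iff.2 hl
  set m := l.length with hmdef
  obtain ⟨C, s₀, hC, hs₀, h⟩ := (hasTransport_multiComm hX (hm.trans hlr) l hl).estimate hm hlr
  refine ⟨C, hC, ?_⟩
  have hpos : (0 : ℝ) < min 1 (s₀ ^ m) := by positivity
  filter_upwards [Ioc_mem_nhdsGT hpos] with τ hτ u hu e g q he he0 hg hq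
  have hle := hτ.2
  rw [le_min_iff] at hle
  have hτ0 := hτ.1
  have hm0 : m ≠ 0 := by omega
  have hmr : (0 : ℝ) < m := by exact_mod_cast hm
  have hrr : (m : ℝ) ≤ r := by exact_mod_cast hlr
  have hinv : 1 / (r : ℝ) ≤ (m : ℝ)⁻¹ := by
    rw [one_div]
    gcongr
  set s : ℝ := τ ^ ((m : ℝ)⁻¹) with hs
  have hs0 : 0 < s := by positivity
  have hsm : s ^ m = τ := Real.rpow_inv_natCast_pow hτ0.le hm0
  have hss : s ≤ s₀ := by
    rw [← Real.pow_rpow_inv_natCast hs₀.le hm0]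
    exact Real.rpow_le_rpow hτ0.le hle.2 (by positivity)
  have b := h s ⟨hs0, hss⟩ u hu e g q he he0 hg hq
  have hu1 : Continuous (fderiv ℝ u) := hu.continuous_fderiv (by simp)
  have hX1 : Continuous (multiComm X l) := (BddSmooth.multiComm hX l).1.continuous
  have b2 : L2le (vfApply (multiComm X l) u) _ := b.of_le_mul (c := τ⁻¹) (by positivity)
    (hu1.clm_apply hX1).aestronglyMeasurable fun x => by
      rw [hsm, norm_smul, Real.norm_of_nonneg hτ0.le, inv_mul_cancel_left₀ hτ0.ne']
  refine b2.mono ?_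
  have e1 : s ≤ τ * τ ^ (1 / (r : ℝ) - 1) := by
    rw [Real.rpow_sub_one hτ0.ne', mul_div_cancel₀ _ hτ0.ne', hs]
    exact Real.rpow_le_rpow_of_exponent_ge hτ0 hle.1 hinv
  have e2 : s ^ (m + 1) ≤ τ * τ ^ (1 / (r : ℝ)) := by
    rw [pow_succ, hsm]
    gcongr
    exact Real.rpow_le_rpow_of_exponent_ge hτ0 hle.1 hinv
  have e3 : s ^ (2 * m) = τ * τ := by rw [mul_comm, pow_mul, hsm, sq]
  have hg0 := hg.2.1
  have hq0 := hq.2.1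
  calc _ ≤ τ⁻¹ * (C * (τ * τ ^ (1 / (r : ℝ) - 1) * e + τ * τ ^ (1 / (r : ℝ)) * g + τ * τ * q)) := by
        rw [e3]
        gcongr
    _ = _ := by
        field_simp

theorem norm_clm_le_sum {F : Type*} [NormedAddCommGroup F] [NormedSpace ℝ F]
    (L : Ec d →L[ℝ] F) :
    ‖L‖ ≤ ∑ k, ‖L (EuclideanSpace.single k (1 : ℝ))‖ := by
  refine L.opNorm_le_bound (Finset.sum_nonneg fun _ _ => norm_nonneg _) fun x => ?_
  have hx : x = ∑ k, x k • EuclideanSpace.single k (1 : ℝ) := by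
    ext i
    simp [Pi.single_apply]
  conv_lhs => rw [hx, map_sum]
  rw [Finset.sum_mul]
  refine (norm_sum_le _ _).trans (Finset.sum_le_sum fun k _ => ?_)
  rw [map_smul, norm_smul, mul_comm]
  gcongr
  exact PiLp.norm_apply_le x k

theorem gradient_estimate {N : ℕ} {X : Fin N → Ec d → Ec d} (hX : ∀ i, BddSmooth (X i)) {r : ℕ}
    (hUH : UniformHormander X r) :
    ∃ C : ℝ, 0 ≤ C ∧ ∀ᶠ τ in nhdsWithin (0 : ℝ) (Set.Ioi 0), ∀ u : Ec d → ℂ,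
      ContDiff ℝ (⊤ : ℕ∞) u → ∀ e g q : ℝ, (∀ i, L2le (vfApply (X i) u) e) → 0 ≤ e →
      L2le (fderiv ℝ u) g → L2le (fderiv ℝ (fderiv ℝ u)) q →
      L2le (fderiv ℝ u) (C * (τ ^ (1 / (r : ℝ) - 1) * e + τ ^ (1 / (r : ℝ)) * g + τ * q)) := by
  choose ψ hψ hψ' using fun k : Fin d => hUH (fun _ => EuclideanSpace.single k (1 : ℝ))
    (BddSmooth.const _)
  choose K hK hK' using fun k l => BddSmooth.exists_bound (hψ k l)
  have hest : ∀ l : List (Fin N), ∃ C : ℝ, 0 ≤ C ∧ (l ≠ [] → l.length ≤ r →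
      ∀ᶠ τ in nhdsWithin (0 : ℝ) (Set.Ioi 0), ∀ u : Ec d → ℂ,
      ContDiff ℝ (⊤ : ℕ∞) u → ∀ e g q : ℝ, (∀ i, L2le (vfApply (X i) u) e) → 0 ≤ e →
      L2le (fderiv ℝ u) g → L2le (fderiv ℝ (fderiv ℝ u)) q →
      L2le (vfApply (multiComm X l) u)
        (C * (τ ^ (1 / (r : ℝ) - 1) * e + τ ^ (1 / (r : ℝ)) * g + τ * q))) := by
    intro l
    by_cases h : l ≠ [] ∧ l.length ≤ r
    · obtain ⟨C, hC, hC'⟩ := multiComm_estimate hX h.1 h.2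
      exact ⟨C, hC, fun _ _ => hC'⟩
    · exact ⟨0, le_rfl, fun h1 h2 => absurd ⟨h1, h2⟩ h⟩
  choose C hC hC' using hest
  refine ⟨∑ k : Fin d, ∑ n ∈ Finset.Icc 1 r, ∑ v : Fin n → Fin N,
    K k (List.ofFn v) * C (List.ofFn v), ?_, ?_⟩
  · exact Finset.sum_nonneg fun k _ => Finset.sum_nonneg fun n _ => Finset.sum_nonneg fun v _ =>
      mul_nonneg (hK _ _) (hC _)
  have hev : ∀ᶠ τ in nhdsWithin (0 : ℝ) (Set.Ioi 0), ∀ n ∈ Finset.Icc 1 r, ∀ v : Fin n → Fin N,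
      ∀ u : Ec d → ℂ,
      ContDiff ℝ (⊤ : ℕ∞) u → ∀ e g q : ℝ, (∀ i, L2le (vfApply (X i) u) e) → 0 ≤ e →
      L2le (fderiv ℝ u) g → L2le (fderiv ℝ (fderiv ℝ u)) q →
      L2le (vfApply (multiComm X (List.ofFn v)) u)
        (C (List.ofFn v) * (τ ^ (1 / (r : ℝ) - 1) * e + τ ^ (1 / (r : ℝ)) * g + τ * q)) := by
    refine (Filter.eventually_all_finset _).2 fun n hn => Filter.eventually_all.2 fun v => ?_
    rw [Finset.mem_Icc] at hn
    exact hC' _ (fun h => by simp at h; omega) (by simpa using hn.2)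
  filter_upwards [hev] with τ hτ u hu e g q he he0 hg hq
  have hu1 : Continuous (fderiv ℝ u) := hu.continuous_fderiv (by simp)
  have hb : L2le (fun x => ∑ k : Fin d, ∑ n ∈ Finset.Icc 1 r, ∑ v : Fin n → Fin N,
      ‖ψ k (List.ofFn v) x • vfApply (multiComm X (List.ofFn v)) u x‖)
      (∑ k : Fin d, ∑ n ∈ Finset.Icc 1 r, ∑ v : Fin n → Fin N, K k (List.ofFn v) *
      (C (List.ofFn v) * (τ ^ (1 / (r : ℝ) - 1) * e + τ ^ (1 / (r : ℝ)) * g + τ * q))) := by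
    refine L2le.sum _ fun k _ => L2le.sum _ fun n hn => L2le.sum _ fun v _ => ?_
    refine ((hτ n hn v u hu e g q he he0 hg hq).of_le_mul (hK k (List.ofFn v)) ?_ fun x => ?_).norm
    · exact ((hψ k (List.ofFn v)).1.continuous.smul (hu1.clm_apply
        (BddSmooth.multiComm hX _).1.continuous)).aestronglyMeasurable
    · rw [norm_smul]
      gcongr
      exact hK' k _ x
  have hb2 := hb.of_norm_le (g := fderiv ℝ u) hu1.aestronglyMeasurable fun x => ?_
  · refine hb2.mono (le_of_eq ?_)
    simp only [Finset.sum_mul, mul_assoc]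
  · rw [Real.norm_of_nonneg (Finset.sum_nonneg fun _ _ => Finset.sum_nonneg fun _ _ =>
      Finset.sum_nonneg fun _ _ => norm_nonneg _)]
    refine (norm_clm_le_sum _).trans (Finset.sum_le_sum fun k _ => ?_)
    rw [hψ' k x, map_sum]
    refine (norm_sum_le _ _).trans (Finset.sum_le_sum fun n _ => ?_)
    rw [map_sum]
    refine (norm_sum_le _ _).trans (Finset.sum_le_sum fun v _ => ?_)
    rw [map_smul]
    rfl

/-- A lower bound for the fields `X i` in terms of the full gradient, at each small scale. -/
theorem gradient_estimate_absorbed {N : ℕ} {X : Fin N → Ec d → Ec d}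
    (hX : ∀ i, BddSmooth (X i)) {r : ℕ} (hr : 1 ≤ r) (hUH : UniformHormander X r) :
    ∃ C τ₀ : ℝ, 0 ≤ C ∧ 0 < τ₀ ∧ ∀ τ ∈ Set.Ioc 0 τ₀, ∀ u : Ec d → ℂ,
      ContDiff ℝ (⊤ : ℕ∞) u → ∀ e g q : ℝ, (∀ i, L2le (vfApply (X i) u) e) → 0 ≤ e →
      L2le (fderiv ℝ u) g → L2le (fderiv ℝ (fderiv ℝ u)) q →
      L2le (fderiv ℝ u) (C * (τ ^ (1 / (r : ℝ) - 1) * e + τ * q)) := by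
  obtain ⟨C, hC, h⟩ := gradient_estimate hX hUH
  have hr0 : (0 : ℝ) < 1 / (r : ℝ) := by positivity
  have hlim : ∀ᶠ τ in nhdsWithin (0 : ℝ) (Set.Ioi 0), C * τ ^ (1 / (r : ℝ)) ≤ 1 / 2 := by
    have h1 : Filter.Tendsto (fun τ : ℝ => C * τ ^ (1 / (r : ℝ))) (nhds 0)
        (nhds (C * 0 ^ (1 / (r : ℝ)))) :=
      ((Real.continuousAt_rpow_const 0 (1 / (r : ℝ)) (Or.inr hr0.le)).tendsto).const_mul C
    rw [Real.zero_rpow hr0.ne', mul_zero] at h1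
    exact (h1.mono_left nhdsWithin_le_nhds).eventually (eventually_le_nhds (by norm_num))
  obtain ⟨τ₀, hτ₀, hτ⟩ := mem_nhdsGT_iff_exists_Ioc_subset.1 (h.and hlim)
  refine ⟨2 * C, τ₀, by positivity, hτ₀, fun τ hτ' u hu e g q he he0 hg hq => ?_⟩
  obtain ⟨h1, h2⟩ := hτ hτ'
  set G : ℝ := (eLpNorm (fderiv ℝ u) 2 volume).toReal with hG
  have hfin : eLpNorm (fderiv ℝ u) 2 volume ≠ ⊤ := ne_top_of_le_ne_top ENNReal.ofReal_ne_top hg.2.2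
  have hGG : L2le (fderiv ℝ u) G :=
    ⟨hg.1, ENNReal.toReal_nonneg, by rw [hG, ENNReal.ofReal_toReal hfin]⟩
  have b := h1 u hu e G q he he0 hGG hq
  have hle : G ≤ C * (τ ^ (1 / (r : ℝ) - 1) * e + τ ^ (1 / (r : ℝ)) * G + τ * q) :=
    ENNReal.toReal_le_of_le_ofReal b.2.1 b.2.2
  refine hGG.mono ?_
  have : C * τ ^ (1 / (r : ℝ)) * G ≤ 1 / 2 * G := by gcongr
  nlinarith

section

open SchwartzMap LineDeriv

/-- The `L²` norm as a seminorm on Schwartz functions. -/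
def schwartzL2 (d : ℕ) : Seminorm ℝ (SchwartzMap (Ec d) ℂ) :=
  (normSeminorm ℝ (Lp ℂ 2 (volume : Measure (Ec d)))).comp
    (toLpCLM ℝ ℂ 2 (volume : Measure (Ec d))).toLinearMap

theorem schwartzL2_eq (f : SchwartzMap (Ec d) ℂ) :
    schwartzL2 d f = (eLpNorm f 2 volume).toReal :=
  norm_toLp

theorem ofReal_schwartzL2 (f : SchwartzMap (Ec d) ℂ) :
    ENNReal.ofReal (schwartzL2 d f) = eLpNorm f 2 volume := by
  rw [schwartzL2_eq, ENNReal.ofReal_toReal (f.eLpNorm_lt_top 2 volume).ne]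

theorem ofReal_schwartzL2_sq (f : SchwartzMap (Ec d) ℂ) :
    ENNReal.ofReal (schwartzL2 d f ^ 2) = ∫⁻ x, ‖f x‖ₑ ^ 2 := by
  rw [ENNReal.ofReal_pow (apply_nonneg _ _), ofReal_schwartzL2, eLpNorm_two_sq]

theorem l2le_schwartz (f : SchwartzMap (Ec d) ℂ) : L2le f (schwartzL2 d f) :=
  ⟨f.continuous.aestronglyMeasurable, apply_nonneg _ _, (ofReal_schwartzL2 f).ge⟩

theorem schwartzL2_le_of_l2le {f : SchwartzMap (Ec d) ℂ} {B : ℝ} (h : L2le f B) :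
    schwartzL2 d f ≤ B := by
  rw [schwartzL2_eq]; exact ENNReal.toReal_le_of_le_ofReal h.2.1 h.2.2

theorem schwartzL2_le_mul {f g : SchwartzMap (Ec d) ℂ} {C : ℝ} (hC : 0 ≤ C)
    (h : ∀ x, ‖f x‖ ≤ C * ‖g x‖) : schwartzL2 d f ≤ C * schwartzL2 d g :=
  schwartzL2_le_of_l2le ((l2le_schwartz g).of_le_mul hC f.continuous.aestronglyMeasurable h)

theorem schwartzL2_fourier (f : SchwartzMap (Ec d) ℂ) : schwartzL2 d (𝓕 f) = schwartzL2 d f :=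
  norm_fourier_toL2_eq f

theorem schwartzL2_csmul (c : ℂ) (f : SchwartzMap (Ec d) ℂ) :
    schwartzL2 d (c • f) = ‖c‖ * schwartzL2 d f := by
  have : schwartzL2 d (c • f) = ‖toLpCLM ℂ ℂ 2 (volume : Measure (Ec d)) (c • f)‖ := rfl
  rw [this, map_smul, norm_smul]; rfl

/-- The Fourier multiplier with a real symbol. -/
abbrev fMul (σ : Ec d → ℝ) : SchwartzMap (Ec d) ℂ →L[ℝ] SchwartzMap (Ec d) ℂ :=
  fourierMultiplierCLM ℂ σ

/-- Multiplication by a real function. -/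
abbrev mulOp (b : Ec d → ℝ) : SchwartzMap (Ec d) ℂ →L[ℝ] SchwartzMap (Ec d) ℂ :=
  smulLeftCLM ℂ b

/-- The partial derivative in the `k`-th coordinate direction. -/
abbrev pDeriv (k : Fin d) : SchwartzMap (Ec d) ℂ →L[ℝ] SchwartzMap (Ec d) ℂ :=
  lineDerivOpCLM ℝ (SchwartzMap (Ec d) ℂ) (EuclideanSpace.single k (1 : ℝ))

theorem fMul_fMul {σ ρ : Ec d → ℝ} (hσ : σ.HasTemperateGrowth) (hρ : ρ.HasTemperateGrowth)
    (f : SchwartzMap (Ec d) ℂ) : fMul σ (fMul ρ f) = fMul (fun ξ => σ ξ * ρ ξ) f :=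
  fourierMultiplierCLM_fourierMultiplierCLM_apply hσ hρ f

theorem fMul_comm {σ ρ : Ec d → ℝ} (hσ : σ.HasTemperateGrowth) (hρ : ρ.HasTemperateGrowth)
    (f : SchwartzMap (Ec d) ℂ) : fMul σ (fMul ρ f) = fMul ρ (fMul σ f) := by
  rw [fMul_fMul hσ hρ, fMul_fMul hρ hσ]; simp_rw [mul_comm]

theorem fMul_csmul {σ : Ec d → ℝ} (hσ : σ.HasTemperateGrowth) (c : ℂ)
    (f : SchwartzMap (Ec d) ℂ) : fMul σ (c • f) = c • fMul σ f := by
  simp only [fMul, ← fourierMultiplierCLM_ofReal ℂ hσ, map_smul]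

theorem fourier_fMul_apply {σ : Ec d → ℝ} (hσ : σ.HasTemperateGrowth)
    (f : SchwartzMap (Ec d) ℂ) (ξ : Ec d) : 𝓕 (fMul σ f) ξ = σ ξ • 𝓕 f ξ := by
  rw [fMul, fourierMultiplierCLM_apply, FourierTransform.fourier_fourierInv_eq,
    smulLeftCLM_apply_apply hσ]

theorem fMul_congr {σ ρ : Ec d → ℝ} (h : ∀ ξ, σ ξ = ρ ξ) (f : SchwartzMap (Ec d) ℂ) :
    fMul σ f = fMul ρ f := by rw [funext h]

theorem fMul_add {σ ρ : Ec d → ℝ} (hσ : σ.HasTemperateGrowth) (hρ : ρ.HasTemperateGrowth)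
    (f : SchwartzMap (Ec d) ℂ) : fMul (fun ξ => σ ξ + ρ ξ) f = fMul σ f + fMul ρ f := by
  have : (fun ξ => σ ξ + ρ ξ) = σ + ρ := rfl
  simp only [fMul, fourierMultiplierCLM_apply, this, smulLeftCLM_add hσ hρ,
    FourierTransform.fourierInv_add, _root_.add_apply]

theorem fMul_const_mul {σ : Ec d → ℝ} (hσ : σ.HasTemperateGrowth) (c : ℝ)
    (f : SchwartzMap (Ec d) ℂ) : fMul (fun ξ => c * σ ξ) f = c • fMul σ f := by
  have : (fun ξ => c * σ ξ) = c • σ := rfl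
  rw [fMul, this, fourierMultiplierCLM_smul hσ]; rfl

theorem fMul_one (f : SchwartzMap (Ec d) ℂ) : fMul (fun _ => 1) f = f := by
  simp [fMul]

theorem schwartzL2_fMul_le {σ ρ : Ec d → ℝ} (hσ : σ.HasTemperateGrowth)
    (hρ : ρ.HasTemperateGrowth) {C : ℝ} (hC : 0 ≤ C) (h : ∀ ξ, |σ ξ| ≤ C * |ρ ξ|)
    (f : SchwartzMap (Ec d) ℂ) : schwartzL2 d (fMul σ f) ≤ C * schwartzL2 d (fMul ρ f) := by
  rw [← schwartzL2_fourier, ← schwartzL2_fourier (fMul ρ f)]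
  refine schwartzL2_le_mul hC fun ξ => ?_
  rw [fourier_fMul_apply hσ, fourier_fMul_apply hρ, norm_smul, norm_smul, ← mul_assoc]
  exact mul_le_mul_of_nonneg_right (h ξ) (norm_nonneg _)

theorem schwartzL2_fMul_le_self {σ : Ec d → ℝ} (hσ : σ.HasTemperateGrowth)
    {C : ℝ} (hC : 0 ≤ C) (h : ∀ ξ, |σ ξ| ≤ C)
    (f : SchwartzMap (Ec d) ℂ) : schwartzL2 d (fMul σ f) ≤ C * schwartzL2 d f := by
  have := schwartzL2_fMul_le hσ (Function.HasTemperateGrowth.const (1 : ℝ)) hC (by simpa using h) f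
  rwa [fMul_one] at this

theorem ofReal_schwartzL2_fMul_sq {σ : Ec d → ℝ} (hσ : σ.HasTemperateGrowth)
    (f : SchwartzMap (Ec d) ℂ) :
    ENNReal.ofReal (schwartzL2 d (fMul σ f) ^ 2) =
      ∫⁻ ξ, ENNReal.ofReal (σ ξ ^ 2) * ‖𝓕 f ξ‖ₑ ^ 2 := by
  rw [← schwartzL2_fourier, ofReal_schwartzL2_sq]
  refine lintegral_congr fun ξ => ?_
  rw [fourier_fMul_apply hσ, enorm_smul, mul_pow, ← sq_abs (σ ξ),
    ENNReal.ofReal_pow (abs_nonneg _), Real.enorm_eq_ofReal_abs]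

theorem coord_temperate (k : Fin d) : (fun ξ : Ec d => ξ k).HasTemperateGrowth :=
  (EuclideanSpace.proj k : Ec d →L[ℝ] ℝ).hasTemperateGrowth

theorem pDeriv_eq (k : Fin d) (f : SchwartzMap (Ec d) ℂ) :
    pDeriv k f = (2 * π * I : ℂ) • fMul (fun ξ => ξ k) f := by
  have h := lineDeriv_eq_fourierMultiplierCLM (EuclideanSpace.single k (1 : ℝ)) f
  have h2 : (fun ξ : Ec d => inner ℝ ξ (EuclideanSpace.single k (1 : ℝ))) = fun ξ => ξ k := by
    ext ξ; simp [EuclideanSpace.inner_single_right]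
  rw [h2] at h
  exact h

theorem pDeriv_apply (k : Fin d) (f : SchwartzMap (Ec d) ℂ) (x : Ec d) :
    pDeriv k f x = fderiv ℝ f x (EuclideanSpace.single k 1) :=
  lineDerivOp_apply_eq_fderiv _ _ _

theorem schwartzL2_pDeriv (k : Fin d) (f : SchwartzMap (Ec d) ℂ) :
    schwartzL2 d (pDeriv k f) = 2 * π * schwartzL2 d (fMul (fun ξ => ξ k) f) := by
  rw [pDeriv_eq, schwartzL2_csmul]
  congr 1
  simp [abs_of_pos Real.pi_pos]

theorem fMul_pDeriv {σ : Ec d → ℝ} (hσ : σ.HasTemperateGrowth) (k : Fin d)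
    (f : SchwartzMap (Ec d) ℂ) : fMul σ (pDeriv k f) = pDeriv k (fMul σ f) := by
  rw [pDeriv_eq, pDeriv_eq, fMul_csmul hσ, fMul_comm hσ (coord_temperate k)]

theorem pDeriv_pDeriv (k l : Fin d) (f : SchwartzMap (Ec d) ℂ) :
    pDeriv k (pDeriv l f) = -(2 * π) ^ 2 • fMul (fun ξ => ξ k * ξ l) f := by
  rw [pDeriv_eq, pDeriv_eq, fMul_csmul (coord_temperate k), smul_smul,
    fMul_fMul (coord_temperate k) (coord_temperate l)]
  ext x
  simp only [smul_apply, Complex.real_smul, smul_eq_mul]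
  push_cast
  ring_nf
  simp

theorem mulOp_apply {b : Ec d → ℝ} (hb : BddSmooth b) (f : SchwartzMap (Ec d) ℂ) (x : Ec d) :
    mulOp b f x = b x • f x :=
  smulLeftCLM_apply_apply hb.hasTemperateGrowth f x

theorem schwartzL2_mulOp {b : Ec d → ℝ} (hb : BddSmooth b) :
    ∃ C, 0 ≤ C ∧ ∀ f, schwartzL2 d (mulOp b f) ≤ C * schwartzL2 d f := by
  obtain ⟨C, hC, h⟩ := hb.exists_bound
  refine ⟨C, hC, fun f => schwartzL2_le_mul hC fun x => ?_⟩
  rw [mulOp_apply hb, norm_smul]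
  exact mul_le_mul_of_nonneg_right (h x) (norm_nonneg _)

/-- The partial derivative of a coefficient function. -/
def coefDeriv (k : Fin d) (b : Ec d → ℝ) : Ec d → ℝ :=
  fun x => fderiv ℝ b x (EuclideanSpace.single k 1)

theorem BddSmooth.coefDeriv {b : Ec d → ℝ} (hb : BddSmooth b) (k : Fin d) :
    BddSmooth (coefDeriv k b) :=
  hb.fderiv.clm_apply (BddSmooth.const _)

theorem pDeriv_mulOp {b : Ec d → ℝ} (hb : BddSmooth b) (k : Fin d) (f : SchwartzMap (Ec d) ℂ) :
    pDeriv k (mulOp b f) = mulOp b (pDeriv k f) + mulOp (coefDeriv k b) f := by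
  ext x
  have h1 : (mulOp b f : Ec d → ℂ) = fun x => b x • f x := funext (mulOp_apply hb f)
  rw [pDeriv_apply, h1, fderiv_fun_smul (hb.1.differentiable (by simp) x) (f.differentiableAt)]
  simp only [add_apply, mulOp_apply hb, mulOp_apply (hb.coefDeriv k), pDeriv_apply]
  simp [coefDeriv]

end

/-- The symbol of the resolvent `(1 + τ²Δ)⁻¹`. -/
def res (τ : ℝ) (ξ : Ec d) : ℝ := (1 + (2 * π * τ) ^ 2 * ‖ξ‖ ^ 2)⁻¹

/-- The symbol `λ² / (1 + λ²)²`, `λ = 2πτ|ξ|`, of a frequency localization at scale `1 / τ`. -/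
def bump (τ : ℝ) (ξ : Ec d) : ℝ := res τ ξ - res τ ξ * res τ ξ

theorem res_denom_pos (τ : ℝ) (ξ : Ec d) : 0 < 1 + (2 * π * τ) ^ 2 * ‖ξ‖ ^ 2 := by positivity

theorem res_pos (τ : ℝ) (ξ : Ec d) : 0 < res τ ξ := inv_pos.2 (res_denom_pos τ ξ)

theorem res_le_one (τ : ℝ) (ξ : Ec d) : res τ ξ ≤ 1 :=
  inv_le_one_of_one_le₀ (by have : 0 ≤ (2 * π * τ) ^ 2 * ‖ξ‖ ^ 2 := by positivity
                            linarith)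

theorem denom_mul_res (τ : ℝ) (ξ : Ec d) : (1 + (2 * π * τ) ^ 2 * ‖ξ‖ ^ 2) * res τ ξ = 1 :=
  mul_inv_cancel₀ (res_denom_pos τ ξ).ne'

theorem bump_eq (τ : ℝ) (ξ : Ec d) : bump τ ξ = (2 * π * τ) ^ 2 * ‖ξ‖ ^ 2 * res τ ξ ^ 2 := by
  have := denom_mul_res τ ξ
  rw [bump]; linear_combination (-res τ ξ) * this

theorem bump_nonneg (τ : ℝ) (ξ : Ec d) : 0 ≤ bump τ ξ := by
  rw [bump_eq]; positivity

theorem res_temperate (τ : ℝ) : (res τ : Ec d → ℝ).HasTemperateGrowth := by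
  have h := (Function.hasTemperateGrowth_one_add_norm_sq_rpow (Ec d) (-1)).comp
    ((2 * π * τ) • ContinuousLinearMap.id ℝ (Ec d)).hasTemperateGrowth
  have h2 : (res τ : Ec d → ℝ) = (fun x : Ec d => (1 + ‖x‖ ^ 2) ^ (-1 : ℝ)) ∘
      ((2 * π * τ) • ContinuousLinearMap.id ℝ (Ec d)) := by
    ext ξ
    simp [Function.comp, res, Real.rpow_neg_one, norm_smul, mul_pow]
  rwa [h2]

theorem bump_temperate (τ : ℝ) : (bump τ : Ec d → ℝ).HasTemperateGrowth :=
  (res_temperate τ).sub ((res_temperate τ).mul (res_temperate τ))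

theorem denom_temperate (τ : ℝ) :
    (fun ξ : Ec d => 1 + (2 * π * τ) ^ 2 * ‖ξ‖ ^ 2).HasTemperateGrowth := by
  fun_prop

theorem coord_mul_temperate (k l : Fin d) : (fun ξ : Ec d => ξ k * ξ l).HasTemperateGrowth :=
  (coord_temperate k).mul (coord_temperate l)

theorem abs_coord_le (k : Fin d) (ξ : Ec d) : |ξ k| ≤ ‖ξ‖ := PiLp.norm_apply_le ξ k

theorem fMul_denom (τ : ℝ) (f : SchwartzMap (Ec d) ℂ) :
    fMul (fun ξ => 1 + (2 * π * τ) ^ 2 * ‖ξ‖ ^ 2) f =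
      f - τ ^ 2 • ∑ k, pDeriv k (pDeriv k f) := by
  rw [fMul_add (Function.HasTemperateGrowth.const (1 : ℝ)) (by fun_prop), fMul_one,
    fMul_const_mul (by fun_prop)]
  have h : fMul (fun ξ : Ec d => ‖ξ‖ ^ 2) f = ∑ k, fMul (fun ξ => ξ k * ξ k) f := by
    have h2 : (fun ξ : Ec d => ‖ξ‖ ^ 2) = (∑ k, (fun ξ : Ec d => ξ k * ξ k) ·) := by
      ext ξ; simp only [EuclideanSpace.real_norm_sq_eq]; simp only [sq]
    rw [fMul, h2, SchwartzMap.fourierMultiplierCLM_sum ℂ fun k _ => coord_mul_temperate k k]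
    simp
  simp only [h, pDeriv_pDeriv, Finset.smul_sum, smul_smul, sub_eq_add_neg, ← Finset.sum_neg_distrib,
    ← neg_smul]
  congr 1
  refine Finset.sum_congr rfl fun k _ => ?_
  congr 1; ring

theorem res_fMul_denom (τ : ℝ) (f : SchwartzMap (Ec d) ℂ) :
    fMul (res τ) (f - τ ^ 2 • ∑ k, pDeriv k (pDeriv k f)) = f := by
  rw [← fMul_denom, fMul_fMul (res_temperate τ) (denom_temperate τ),
    fMul_congr (ρ := fun _ => 1), fMul_one]
  intro ξ; rw [mul_comm, denom_mul_res]

theorem denom_res_fMul (τ : ℝ) (f : SchwartzMap (Ec d) ℂ) :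
    fMul (res τ) f - τ ^ 2 • ∑ k, pDeriv k (pDeriv k (fMul (res τ) f)) = f := by
  rw [← fMul_denom, fMul_fMul (denom_temperate τ) (res_temperate τ),
    fMul_congr (ρ := fun _ => 1), fMul_one]
  intro ξ; rw [denom_mul_res]

theorem resolvent_commutator {b : Ec d → ℝ} (hb : BddSmooth b) (τ : ℝ)
    (f : SchwartzMap (Ec d) ℂ) :
    fMul (res τ) (mulOp b f) - mulOp b (fMul (res τ) f) =
      τ ^ 2 • ∑ k, (2 : ℝ) • fMul (res τ) (mulOp (coefDeriv k b) (pDeriv k (fMul (res τ) f))) +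
        τ ^ 2 • ∑ k, fMul (res τ) (mulOp (coefDeriv k (coefDeriv k b)) (fMul (res τ) f)) := by
  set g := fMul (res τ) f with hg
  have h1 : mulOp b f = (mulOp b g - τ ^ 2 • ∑ k, pDeriv k (pDeriv k (mulOp b g))) +
      (τ ^ 2 • ∑ k, (2 : ℝ) • mulOp (coefDeriv k b) (pDeriv k g) +
        τ ^ 2 • ∑ k, mulOp (coefDeriv k (coefDeriv k b)) g) := by
    conv_lhs => rw [← denom_res_fMul τ f, ← hg]
    simp only [pDeriv_mulOp hb, map_add, pDeriv_mulOp (hb.coefDeriv _), map_sub, map_smul, map_sum,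
      Finset.sum_add_distrib, smul_add, two_smul]
    abel
  rw [h1, map_add, res_fMul_denom]
  simp only [map_add, map_smul, map_sum]
  abel

theorem mul_norm_mul_res_le (τ : ℝ) (ξ : Ec d) : 2 * π * τ * ‖ξ‖ * res τ ξ ≤ 1 := by
  have h1 := denom_mul_res τ ξ
  have h2 := res_pos τ ξ
  nlinarith [sq_nonneg (2 * π * τ * ‖ξ‖ - 1), mul_nonneg (sq_nonneg (2 * π * τ * ‖ξ‖)) h2.le,
    mul_nonneg (sq_nonneg (2 * π * τ * ‖ξ‖ - 1)) h2.le]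

theorem two_pi_mul_pos {τ : ℝ} (hτ : 0 < τ) : 0 < 2 * π * τ := by positivity

theorem schwartzL2_res_le (τ : ℝ) (f : SchwartzMap (Ec d) ℂ) :
    schwartzL2 d (fMul (res τ) f) ≤ schwartzL2 d f := by
  simpa using schwartzL2_fMul_le_self (res_temperate τ) zero_le_one
    (fun ξ => by rw [abs_of_pos (res_pos τ ξ)]; exact res_le_one τ ξ) f

theorem schwartzL2_pDeriv_res_le {τ : ℝ} (hτ : 0 < τ) (k : Fin d) (f : SchwartzMap (Ec d) ℂ) :
    τ * schwartzL2 d (pDeriv k (fMul (res τ) f)) ≤ schwartzL2 d f := by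
  have hp := two_pi_mul_pos hτ
  rw [schwartzL2_pDeriv, fMul_fMul (coord_temperate k) (res_temperate τ)]
  have h := schwartzL2_fMul_le_self ((coord_temperate k).mul (res_temperate τ))
    (inv_nonneg.2 hp.le) (fun ξ => ?_) f
  · calc _ = (2 * π * τ) * schwartzL2 d (fMul (fun ξ => ξ k * res τ ξ) f) := by ring
      _ ≤ (2 * π * τ) * ((2 * π * τ)⁻¹ * schwartzL2 d f) := by gcongr; exact h
      _ = _ := by field_simp
  · simp only [Pi.mul_apply]
    rw [abs_mul, abs_of_pos (res_pos τ ξ), ← one_div, le_div_iff₀ hp]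
    have h1 := mul_norm_mul_res_le τ ξ
    have h2 := mul_le_mul_of_nonneg_left (abs_coord_le k ξ)
      (mul_pos hp (res_pos τ ξ)).le
    linarith

theorem schwartzL2_pDeriv_pDeriv_le {τ C : ℝ} (hC : 0 ≤ C) {σ ρ : Ec d → ℝ}
    (hσ : σ.HasTemperateGrowth) (hρ : ρ.HasTemperateGrowth)
    (h : ∀ ξ, (2 * π * τ) ^ 2 * ‖ξ‖ ^ 2 * |σ ξ| ≤ C * |ρ ξ|) (k l : Fin d)
    (f : SchwartzMap (Ec d) ℂ) :
    τ ^ 2 * schwartzL2 d (pDeriv k (pDeriv l (fMul σ f))) ≤ C * schwartzL2 d (fMul ρ f) := by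
  have hkl : (fun ξ : Ec d => ξ k * ξ l * σ ξ).HasTemperateGrowth :=
    (coord_mul_temperate k l).mul hσ
  rw [pDeriv_pDeriv, map_smul_eq_mul, fMul_fMul (coord_mul_temperate k l) hσ, norm_neg,
    Real.norm_of_nonneg (by positivity), ← mul_assoc, ← Real.norm_of_nonneg
      (r := τ ^ 2 * (2 * π) ^ 2) (by positivity), ← map_smul_eq_mul, ← fMul_const_mul hkl]
  refine schwartzL2_fMul_le ((Function.HasTemperateGrowth.const _).mul hkl) hρ hC (fun ξ => ?_) f
  refine le_trans ?_ (h ξ)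
  simp only [Pi.mul_apply]
  rw [abs_mul, abs_mul (ξ k * ξ l), abs_mul (ξ k), abs_of_nonneg (by positivity)]
  calc _ ≤ τ ^ 2 * (2 * π) ^ 2 * (‖ξ‖ * ‖ξ‖ * |σ ξ|) := by
        gcongr <;> exact abs_coord_le _ _
    _ = _ := by ring

theorem schwartzL2_pDeriv_pDeriv_res_le (τ : ℝ) (k l : Fin d) (f : SchwartzMap (Ec d) ℂ) :
    τ ^ 2 * schwartzL2 d (pDeriv k (pDeriv l (fMul (res τ) f))) ≤ schwartzL2 d f := by
  have h := schwartzL2_pDeriv_pDeriv_le (τ := τ) zero_le_one (res_temperate τ)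
    (Function.HasTemperateGrowth.const (1 : ℝ)) (fun ξ => ?_) k l f
  · rwa [fMul_one, one_mul] at h
  · have := denom_mul_res τ ξ
    rw [abs_of_pos (res_pos τ ξ), abs_one]
    have := res_pos τ ξ
    linarith

theorem schwartzL2_sum_le {ι : Type*} (s : Finset ι) (f : ι → SchwartzMap (Ec d) ℂ) :
    schwartzL2 d (∑ i ∈ s, f i) ≤ ∑ i ∈ s, schwartzL2 d (f i) :=
  Finset.le_sum_of_subadditive _ (map_zero _).le (map_add_le_add _) s f

theorem commutator_mulOp {b : Ec d → ℝ} (hb : BddSmooth b) :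
    ∃ C, 0 ≤ C ∧ ∀ τ ∈ Set.Ioc (0 : ℝ) 1, ∀ f,
      schwartzL2 d (fMul (res τ) (mulOp b f) - mulOp b (fMul (res τ) f)) ≤
        C * (τ * schwartzL2 d f) := by
  choose A hA0 hA using fun k : Fin d => schwartzL2_mulOp (hb.coefDeriv k)
  choose B hB0 hB using fun k : Fin d => schwartzL2_mulOp ((hb.coefDeriv k).coefDeriv k)
  refine ⟨∑ k, 2 * A k + ∑ k, B k, add_nonneg (Finset.sum_nonneg fun k _ => mul_nonneg zero_le_two (hA0 k))
    (Finset.sum_nonneg fun k _ => hB0 k), fun τ hτ f => ?_⟩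
  have hτ0 := hτ.1
  have hn : 0 ≤ schwartzL2 d f := apply_nonneg _ _
  rw [resolvent_commutator hb]
  refine (map_add_le_add _ _ _).trans ?_
  rw [map_smul_eq_mul, map_smul_eq_mul, add_mul, Real.norm_of_nonneg (sq_nonneg τ)]
  refine add_le_add ?_ ?_
  · refine (mul_le_mul_of_nonneg_left (schwartzL2_sum_le _ _) (sq_nonneg τ)).trans ?_
    rw [Finset.mul_sum, Finset.sum_mul]
    refine Finset.sum_le_sum fun k _ => ?_
    rw [map_smul_eq_mul, Real.norm_of_nonneg zero_le_two]
    calc _ ≤ τ ^ 2 * (2 * (A k * schwartzL2 d (pDeriv k (fMul (res τ) f)))) := by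
          gcongr; exact (schwartzL2_res_le _ _).trans (hA k _)
      _ = 2 * A k * (τ * (τ * schwartzL2 d (pDeriv k (fMul (res τ) f)))) := by ring
      _ ≤ _ := by
          have := hA0 k
          gcongr; exact schwartzL2_pDeriv_res_le hτ0 k f
  · refine (mul_le_mul_of_nonneg_left (schwartzL2_sum_le _ _) (sq_nonneg τ)).trans ?_
    rw [Finset.mul_sum, Finset.sum_mul]
    refine Finset.sum_le_sum fun k _ => ?_
    calc _ ≤ τ ^ 2 * (B k * schwartzL2 d f) := by
          gcongr
          exact (schwartzL2_res_le _ _).trans ((hB k _).trans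
            (mul_le_mul_of_nonneg_left (schwartzL2_res_le _ _) (hB0 k)))
      _ = τ * (B k * (τ * schwartzL2 d f)) := by ring
      _ ≤ 1 * (B k * (τ * schwartzL2 d f)) := by
          have := hB0 k
          gcongr; exact hτ.2
      _ = _ := one_mul _

theorem bump_dominates (τ : ℝ) (ξ : Ec d) :
    (2 * π * τ) ^ 2 * ‖ξ‖ ^ 2 * |res τ ξ * res τ ξ| ≤ 1 * |bump τ ξ| := by
  rw [abs_of_nonneg (bump_nonneg τ ξ), bump_eq, abs_of_nonneg (mul_self_nonneg _)]
  exact le_of_eq (by ring)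

theorem commutator_mulOp_pDeriv {b : Ec d → ℝ} (hb : BddSmooth b) (l : Fin d) :
    ∃ C, 0 ≤ C ∧ ∀ τ ∈ Set.Ioc (0 : ℝ) 1, ∀ f,
      schwartzL2 d (fMul (res τ) (mulOp b (pDeriv l f)) - mulOp b (pDeriv l (fMul (res τ) f))) ≤
        C * (schwartzL2 d (fMul (bump τ) f) + τ * schwartzL2 d f) := by
  choose A hA0 hA using fun k : Fin d => schwartzL2_mulOp (hb.coefDeriv k)
  choose K hK0 hK using fun k : Fin d => commutator_mulOp (hb.coefDeriv k)
  choose B hB0 hB using fun k : Fin d => schwartzL2_mulOp ((hb.coefDeriv k).coefDeriv k)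
  refine ⟨∑ k, 2 * (A k + K k) + ∑ k, B k,
    add_nonneg (Finset.sum_nonneg fun k _ => mul_nonneg zero_le_two (add_nonneg (hA0 k) (hK0 k)))
    (Finset.sum_nonneg fun k _ => hB0 k), fun τ hτ f => ?_⟩
  have hτ0 := hτ.1
  have hn : 0 ≤ schwartzL2 d f := apply_nonneg _ _
  have hp : 0 ≤ schwartzL2 d (fMul (bump τ) f) := apply_nonneg _ _
  rw [← fMul_pDeriv (res_temperate τ), resolvent_commutator hb, fMul_pDeriv (res_temperate τ)]
  refine (map_add_le_add _ _ _).trans ?_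
  rw [map_smul_eq_mul, map_smul_eq_mul, add_mul, Real.norm_of_nonneg (sq_nonneg τ)]
  refine add_le_add ?_ ?_
  · refine (mul_le_mul_of_nonneg_left (schwartzL2_sum_le _ _) (sq_nonneg τ)).trans ?_
    rw [Finset.mul_sum, Finset.sum_mul]
    refine Finset.sum_le_sum fun k _ => ?_
    rw [map_smul_eq_mul, Real.norm_of_nonneg zero_le_two]
    set h := pDeriv k (pDeriv l (fMul (res τ) f)) with hh
    have e1 : schwartzL2 d (fMul (res τ) (mulOp (coefDeriv k b) h)) ≤
        K k * (τ * schwartzL2 d h) + A k * schwartzL2 d (fMul (res τ) h) := by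
      have := map_add_le_add (schwartzL2 d)
        (fMul (res τ) (mulOp (coefDeriv k b) h) - mulOp (coefDeriv k b) (fMul (res τ) h))
        (mulOp (coefDeriv k b) (fMul (res τ) h))
      rw [sub_add_cancel] at this
      exact this.trans (add_le_add (hK k τ hτ h) (hA k _))
    have e2 : τ ^ 2 * schwartzL2 d h ≤ schwartzL2 d f := schwartzL2_pDeriv_pDeriv_res_le τ k l f
    have e3 : τ ^ 2 * schwartzL2 d (fMul (res τ) h) ≤ schwartzL2 d (fMul (bump τ) f) := by
      rw [hh, fMul_pDeriv (res_temperate τ), fMul_pDeriv (res_temperate τ),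
        fMul_fMul (res_temperate τ) (res_temperate τ)]
      refine (schwartzL2_pDeriv_pDeriv_le zero_le_one ((res_temperate τ).mul (res_temperate τ))
        (bump_temperate τ) (bump_dominates τ) k l f).trans_eq (one_mul _)
    have hAk := hA0 k
    have hKk := hK0 k
    calc _ ≤ τ ^ 2 * (2 * (K k * (τ * schwartzL2 d h) + A k * schwartzL2 d (fMul (res τ) h))) := by
          gcongr
      _ = 2 * (K k * (τ * (τ ^ 2 * schwartzL2 d h)) +
            A k * (τ ^ 2 * schwartzL2 d (fMul (res τ) h))) := by ring
      _ ≤ 2 * (K k * (τ * schwartzL2 d f) + A k * schwartzL2 d (fMul (bump τ) f)) := by gcongr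
      _ ≤ _ := by
          have := mul_nonneg hKk hp
          have := mul_nonneg hAk (mul_nonneg hτ0.le hn)
          nlinarith
  · refine (mul_le_mul_of_nonneg_left (schwartzL2_sum_le _ _) (sq_nonneg τ)).trans ?_
    rw [Finset.mul_sum, Finset.sum_mul]
    refine Finset.sum_le_sum fun k _ => ?_
    have hBk := hB0 k
    calc _ ≤ τ ^ 2 * (B k * schwartzL2 d (pDeriv l (fMul (res τ) f))) := by
          gcongr
          exact (schwartzL2_res_le _ _).trans (hB k _)
      _ = B k * (τ * (τ * schwartzL2 d (pDeriv l (fMul (res τ) f)))) := by ring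
      _ ≤ B k * (τ * schwartzL2 d f) := by gcongr; exact schwartzL2_pDeriv_res_le hτ0 l f
      _ ≤ _ := by gcongr; linarith

/-- A vector field acting on Schwartz functions. -/
def vfSchwartz (a : Ec d → Ec d) : SchwartzMap (Ec d) ℂ →L[ℝ] SchwartzMap (Ec d) ℂ :=
  ∑ l, (mulOp fun x => a x l) ∘L pDeriv l

theorem vfSchwartz_eq (a : Ec d → Ec d) (f : SchwartzMap (Ec d) ℂ) :
    vfSchwartz a f = ∑ l, mulOp (fun x => a x l) (pDeriv l f) := by
  simp [vfSchwartz]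

theorem BddSmooth.coord {a : Ec d → Ec d} (ha : BddSmooth a) (l : Fin d) :
    BddSmooth fun x => a x l :=
  ha.clm_comp (EuclideanSpace.proj l : Ec d →L[ℝ] ℝ)

theorem vfSchwartz_apply {a : Ec d → Ec d} (ha : BddSmooth a) (f : SchwartzMap (Ec d) ℂ) :
    (vfSchwartz a f : Ec d → ℂ) = vfApply a f := by
  ext x
  rw [vfSchwartz_eq, _root_.sum_apply, vfApply]
  simp only [mulOp_apply (ha.coord _), pDeriv_apply, ← map_smul, ← map_sum]
  congr 1
  ext i
  simp [Pi.single_apply]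

theorem commutator_vfSchwartz {a : Ec d → Ec d} (ha : BddSmooth a) :
    ∃ C, 0 ≤ C ∧ ∀ τ ∈ Set.Ioc (0 : ℝ) 1, ∀ f,
      schwartzL2 d (fMul (res τ) (vfSchwartz a f) - vfSchwartz a (fMul (res τ) f)) ≤
        C * (schwartzL2 d (fMul (bump τ) f) + τ * schwartzL2 d f) := by
  choose A hA0 hA using fun l : Fin d => commutator_mulOp_pDeriv (ha.coord l) l
  refine ⟨∑ l, A l, Finset.sum_nonneg fun l _ => hA0 l, fun τ hτ f => ?_⟩
  rw [vfSchwartz_eq, vfSchwartz_eq, map_sum, ← Finset.sum_sub_distrib, Finset.sum_mul]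
  exact (schwartzL2_sum_le _ _).trans (Finset.sum_le_sum fun l _ => hA l τ hτ f)

theorem fMul_bump (τ : ℝ) (f : SchwartzMap (Ec d) ℂ) :
    fMul (bump τ) f = fMul (res τ) f - fMul (res τ) (fMul (res τ) f) := by
  have h := fMul_add (bump_temperate τ) ((res_temperate τ).mul (res_temperate τ)) f
  rw [fMul_fMul (res_temperate τ) (res_temperate τ), eq_sub_iff_add_eq]
  refine Eq.trans h.symm (fMul_congr (fun ξ => ?_) f)
  simp [bump]

theorem vfSchwartz_bump_le {a : Ec d → Ec d} (ha : BddSmooth a) :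
    ∃ C, 0 ≤ C ∧ ∀ τ ∈ Set.Ioc (0 : ℝ) 1, ∀ f,
      schwartzL2 d (vfSchwartz a (fMul (bump τ) f)) ≤ schwartzL2 d (fMul (bump τ) (vfSchwartz a f)) +
        C * (schwartzL2 d (fMul (bump τ) f) + τ * schwartzL2 d f) := by
  obtain ⟨C, hC, h⟩ := commutator_vfSchwartz ha
  refine ⟨3 * C, by positivity, fun τ hτ f => ?_⟩
  have hτ0 := hτ.1
  set J := fMul (d := d) (res τ) with hJ
  set V := vfSchwartz a with hV
  have e : V (fMul (bump τ) f) = fMul (bump τ) (V f) - (J (V f) - V (J f)) +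
      J (J (V f) - V (J f)) + (J (V (J f)) - V (J (J f))) := by
    rw [fMul_bump, fMul_bump]
    simp only [map_sub]
    abel
  have h1 := h τ hτ f
  have h2 := h τ hτ (J f)
  have h3 : schwartzL2 d (fMul (bump τ) (J f)) ≤ schwartzL2 d (fMul (bump τ) f) := by
    rw [hJ, fMul_comm (bump_temperate τ) (res_temperate τ)]
    exact schwartzL2_res_le _ _
  have h4 : schwartzL2 d (J f) ≤ schwartzL2 d f := schwartzL2_res_le _ _
  have h5 : C * (schwartzL2 d (fMul (bump τ) (J f)) + τ * schwartzL2 d (J f)) ≤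
    C * (schwartzL2 d (fMul (bump τ) f) + τ * schwartzL2 d f) := by gcongr
  have h6 := schwartzL2_res_le τ (J (V f) - V (J f))
  have h7 := map_sub_le_add (schwartzL2 d) (fMul (bump τ) (V f)) (J (V f) - V (J f))
  have h8 := map_add_le_add (schwartzL2 d) (fMul (bump τ) (V f) - (J (V f) - V (J f)))
    (J (J (V f) - V (J f)))
  have h9 := map_add_le_add (schwartzL2 d) (fMul (bump τ) (V f) - (J (V f) - V (J f)) +
    J (J (V f) - V (J f))) (J (V (J f)) - V (J (J f)))
  rw [e]
  linarith

section

open SchwartzMap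

theorem l2le_fderiv_schwartz (f : SchwartzMap (Ec d) ℂ) :
    L2le (fderiv ℝ f) (∑ k, schwartzL2 d (pDeriv k f)) := by
  refine (L2le.sum univ fun k _ => (l2le_schwartz (pDeriv k f)).norm).of_norm_le
    (f.smooth'.continuous_fderiv (by simp)).aestronglyMeasurable fun x => ?_
  rw [Real.norm_of_nonneg (Finset.sum_nonneg fun _ _ => norm_nonneg _)]
  refine (norm_clm_le_sum _).trans (Finset.sum_le_sum fun k _ => ?_)
  rw [pDeriv_apply]

theorem l2le_fderiv_fderiv_schwartz (f : SchwartzMap (Ec d) ℂ) :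
    L2le (fderiv ℝ (fderiv ℝ f)) (∑ k, ∑ l, schwartzL2 d (pDeriv k (pDeriv l f))) := by
  have hs : ContDiff ℝ (⊤ : ℕ∞) (fderiv ℝ f) := f.smooth'.fderiv_right (by simp)
  refine (L2le.sum univ fun k _ => L2le.sum univ fun l _ =>
    (l2le_schwartz (pDeriv k (pDeriv l f))).norm).of_norm_le
    (hs.continuous_fderiv (by simp)).aestronglyMeasurable fun x => ?_
  rw [Real.norm_of_nonneg (Finset.sum_nonneg fun _ _ => Finset.sum_nonneg fun _ _ => norm_nonneg _)]
  refine (norm_clm_le_sum _).trans (Finset.sum_le_sum fun k _ =>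
    (norm_clm_le_sum _).trans (Finset.sum_le_sum fun l _ => le_of_eq ?_))
  have h1 : (pDeriv l f : Ec d → ℂ) = fun y => fderiv ℝ f y (EuclideanSpace.single l 1) :=
    funext (pDeriv_apply l f)
  rw [pDeriv_apply, h1, fderiv_clm_apply (hs.differentiable (by simp) x) (by fun_prop)]
  simp

theorem schwartzL2_pDeriv_le_of_l2le {f : SchwartzMap (Ec d) ℂ} {B : ℝ}
    (h : L2le (fderiv ℝ f) B) (k : Fin d) : schwartzL2 d (pDeriv k f) ≤ B := by
  refine schwartzL2_le_of_l2le (h.of_norm_le (pDeriv k f).continuous.aestronglyMeasurable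
    fun x => ?_)
  rw [pDeriv_apply]
  refine (ContinuousLinearMap.le_opNorm _ _).trans_eq ?_
  simp

/-- The symbol `λ² · bump`, `λ = 2πτ|ξ|`. -/
def bump₂ (τ : ℝ) (ξ : Ec d) : ℝ := (2 * π * τ) ^ 2 * ‖ξ‖ ^ 2 * bump τ ξ

theorem bump₂_temperate (τ : ℝ) : (bump₂ τ : Ec d → ℝ).HasTemperateGrowth :=
  Function.HasTemperateGrowth.mul (by fun_prop) (bump_temperate τ)

theorem localized_gradient_estimate {N : ℕ} {X : Fin N → Ec d → Ec d}
    (hX : ∀ i, BddSmooth (X i)) {r : ℕ} (hr : 1 ≤ r) (hUH : UniformHormander X r) :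
    ∃ C τ₀ : ℝ, 0 ≤ C ∧ 0 < τ₀ ∧ ∀ ε ∈ Set.Ioc 0 τ₀, ∀ τ ∈ Set.Ioc (0 : ℝ) 1,
      ∀ (f : SchwartzMap (Ec d) ℂ) (k : Fin d),
      τ * schwartzL2 d (pDeriv k (fMul (bump τ) f)) ≤
        C * (ε ^ (1 / (r : ℝ) - 1) * τ ^ (1 / (r : ℝ)) *
          (∑ i, schwartzL2 d (fMul (bump τ) (vfSchwartz (X i) f)) +
            schwartzL2 d (fMul (bump τ) f) + τ * schwartzL2 d f) +
          ε * schwartzL2 d (fMul (bump₂ τ) f)) := by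
  obtain ⟨C, τ₀, hC, hτ₀, h⟩ := gradient_estimate_absorbed hX hr hUH
  choose A hA0 hA using fun i => vfSchwartz_bump_le (hX i)
  set K : ℝ := 1 + ∑ i, A i + d * d with hK
  have hA1 : 0 ≤ ∑ i, A i := Finset.sum_nonneg fun i _ => hA0 i
  refine ⟨C * K, τ₀, by positivity, hτ₀, fun ε hε τ hτ f k => ?_⟩
  have hτ0 := hτ.1
  have hε0 := hε.1
  set u := fMul (bump τ) f with hu
  set E := ∑ i, schwartzL2 d (fMul (bump τ) (vfSchwartz (X i) f)) + schwartzL2 d u +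
    τ * schwartzL2 d f with hE
  clear_value E
  have n1 : 0 ≤ schwartzL2 d u := apply_nonneg _ _
  have n2 : 0 ≤ schwartzL2 d f := apply_nonneg _ _
  have n4 : 0 ≤ schwartzL2 d (fMul (bump₂ τ) f) := apply_nonneg _ _
  have n3 : 0 ≤ ∑ i, schwartzL2 d (fMul (bump τ) (vfSchwartz (X i) f)) :=
    Finset.sum_nonneg fun _ _ => apply_nonneg _ _
  have nE : 0 ≤ E := hE ▸ add_nonneg (add_nonneg n3 n1) (mul_nonneg hτ0.le n2)
  have he : ∑ i, schwartzL2 d (vfSchwartz (X i) u) ≤ K * E := by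
    calc _ ≤ ∑ i, (schwartzL2 d (fMul (bump τ) (vfSchwartz (X i) f)) +
          A i * (schwartzL2 d u + τ * schwartzL2 d f)) :=
          Finset.sum_le_sum fun i _ => hA i τ hτ f
      _ = ∑ i, schwartzL2 d (fMul (bump τ) (vfSchwartz (X i) f)) +
          (∑ i, A i) * (schwartzL2 d u + τ * schwartzL2 d f) := by
          rw [Finset.sum_add_distrib, Finset.sum_mul]
      _ ≤ 1 * E + (∑ i, A i) * E + d * d * E := by
          have h1 : schwartzL2 d u + τ * schwartzL2 d f ≤ E := by rw [hE]; linarith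
          have h2 := mul_le_mul_of_nonneg_left h1 hA1
          have h3 : 0 ≤ (d : ℝ) * d * E := by positivity
          have h4 : 0 ≤ τ * schwartzL2 d f := by positivity
          linarith
      _ = K * E := by rw [hK]; ring
  have hq : τ ^ 2 * ∑ k, ∑ l, schwartzL2 d (pDeriv k (pDeriv l u)) ≤
      K * schwartzL2 d (fMul (bump₂ τ) f) := by
    calc _ = ∑ k, ∑ l, τ ^ 2 * schwartzL2 d (pDeriv k (pDeriv l u)) := by
          simp only [Finset.mul_sum]
      _ ≤ ∑ k : Fin d, ∑ l : Fin d, schwartzL2 d (fMul (bump₂ τ) f) := by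
          refine Finset.sum_le_sum fun k _ => Finset.sum_le_sum fun l _ => ?_
          refine (schwartzL2_pDeriv_pDeriv_le zero_le_one (bump_temperate τ) (bump₂_temperate τ)
            (fun ξ => ?_) k l f).trans_eq (one_mul _)
          rw [bump₂, abs_mul, abs_of_nonneg (a := (2 * π * τ) ^ 2 * ‖ξ‖ ^ 2) (by positivity),
            one_mul]
      _ = (d * d : ℝ) * schwartzL2 d (fMul (bump₂ τ) f) := by
          simp only [Finset.sum_const, Finset.card_univ, Fintype.card_fin, nsmul_eq_mul]; ring
      _ ≤ _ := by gcongr; rw [hK]; linarith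
  have hετ : ε * τ ∈ Set.Ioc 0 τ₀ :=
    ⟨by positivity, (mul_le_of_le_one_right hε0.le hτ.2).trans hε.2⟩
  have b := h (ε * τ) hετ u u.smooth' (∑ i, schwartzL2 d (vfSchwartz (X i) u)) _ _
    (fun i => by
      rw [← vfSchwartz_apply (hX i)]
      exact (l2le_schwartz _).mono (Finset.single_le_sum
        (f := fun i => schwartzL2 d (vfSchwartz (X i) u)) (fun _ _ => apply_nonneg _ _)
        (Finset.mem_univ i)))
    (Finset.sum_nonneg fun _ _ => apply_nonneg _ _) (l2le_fderiv_schwartz u)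
    (l2le_fderiv_fderiv_schwartz u)
  have b' := schwartzL2_pDeriv_le_of_l2le b k
  have hpow : τ * (ε * τ) ^ (1 / (r : ℝ) - 1) = ε ^ (1 / (r : ℝ) - 1) * τ ^ (1 / (r : ℝ)) := by
    rw [Real.mul_rpow hε0.le hτ0.le, Real.rpow_sub_one hτ0.ne']
    field_simp
  calc _ ≤ τ * (C * ((ε * τ) ^ (1 / (r : ℝ) - 1) * ∑ i, schwartzL2 d (vfSchwartz (X i) u) +
        ε * τ * ∑ k, ∑ l, schwartzL2 d (pDeriv k (pDeriv l u)))) := by gcongr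
    _ = C * ((τ * (ε * τ) ^ (1 / (r : ℝ) - 1)) * ∑ i, schwartzL2 d (vfSchwartz (X i) u) +
        ε * (τ ^ 2 * ∑ k, ∑ l, schwartzL2 d (pDeriv k (pDeriv l u)))) := by ring
    _ ≤ C * ((τ * (ε * τ) ^ (1 / (r : ℝ) - 1)) * (K * E) +
        ε * (K * schwartzL2 d (fMul (bump₂ τ) f))) := by gcongr
    _ = _ := by rw [hpow]; ring

end

section

open SchwartzMap

/-- The frequency-weighted energy of `f`. -/
def spectralEnergy (σ : Ec d → ℝ) (f : SchwartzMap (Ec d) ℂ) : ENNReal :=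
  ∫⁻ ξ, ENNReal.ofReal (σ ξ) * ‖𝓕 f ξ‖ₑ ^ 2

theorem spectralEnergy_const_mul {σ : Ec d → ℝ} {c : ℝ} (hc : 0 ≤ c)
    (f : SchwartzMap (Ec d) ℂ) :
    spectralEnergy (fun ξ => c * σ ξ) f = ENNReal.ofReal c * spectralEnergy σ f := by
  simp only [spectralEnergy, ENNReal.ofReal_mul hc, mul_assoc]
  rw [lintegral_const_mul' _ _ ENNReal.ofReal_ne_top]

theorem ofReal_mul_schwartzL2_fMul_sq {σ : Ec d → ℝ} (hσ : σ.HasTemperateGrowth) {c : ℝ}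
    (hc : 0 ≤ c) (f : SchwartzMap (Ec d) ℂ) :
    ENNReal.ofReal (c * schwartzL2 d (fMul σ f) ^ 2) =
      spectralEnergy (fun ξ => c * σ ξ ^ 2) f := by
  rw [ENNReal.ofReal_mul hc, ofReal_schwartzL2_fMul_sq hσ, spectralEnergy_const_mul hc]
  rfl

theorem spectralEnergy_gradient {σ : Ec d → ℝ} (hσ : σ.HasTemperateGrowth) {c : ℝ}
    (hc : 0 ≤ c) (τ : ℝ) (f : SchwartzMap (Ec d) ℂ) :
    spectralEnergy (fun ξ => c * ((2 * π * τ) ^ 2 * ‖ξ‖ ^ 2 * σ ξ ^ 2)) f =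
      ENNReal.ofReal (c * ∑ k, (τ * schwartzL2 d (pDeriv k (fMul σ f))) ^ 2) := by
  have h1 : ∀ k, (τ * schwartzL2 d (pDeriv k (fMul σ f))) ^ 2 =
      (2 * π * τ) ^ 2 * schwartzL2 d (fMul (fun ξ => ξ k * σ ξ) f) ^ 2 := fun k => by
    rw [schwartzL2_pDeriv, fMul_fMul (coord_temperate k) hσ]; ring
  simp only [h1, Finset.mul_sum, ← mul_assoc]
  rw [ENNReal.ofReal_sum_of_nonneg fun k _ => by positivity]
  have h2 : ∀ k : Fin d, ENNReal.ofReal (c * (2 * π * τ) ^ 2 *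
      schwartzL2 d (fMul (fun ξ => ξ k * σ ξ) f) ^ 2) =
      spectralEnergy (fun ξ => c * (2 * π * τ) ^ 2 * (ξ k * σ ξ) ^ 2) f := fun k =>
    ofReal_mul_schwartzL2_fMul_sq ((coord_temperate k).mul hσ) (by positivity) f
  simp only [h2, spectralEnergy]
  have hσm : Measurable σ := hσ.1.continuous.measurable
  have hfm : Measurable (fun ξ => 𝓕 f ξ) := (𝓕 f).continuous.measurable
  rw [← lintegral_finsetSum]
  · refine lintegral_congr fun ξ => ?_
    rw [← Finset.sum_mul, ← ENNReal.ofReal_sum_of_nonneg fun k _ => by positivity,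
      EuclideanSpace.real_norm_sq_eq, Finset.mul_sum, Finset.sum_mul]
    congr 3
    ext k; ring
  · intro k _
    fun_prop

theorem sq_le_of_le_mul_add {ι : Type*} [Fintype ι] {x C a b c e t : ℝ} {s : ι → ℝ} (hx : 0 ≤ x)
    (h : x ≤ C * (a * (∑ i, s i + b + c) + e * t)) :
    x ^ 2 ≤ 6 * C ^ 2 * (Fintype.card ι + 1) *
      (a ^ 2 * (∑ i, s i ^ 2 + b ^ 2 + c ^ 2) + e ^ 2 * t ^ 2) := by
  have h1 : (∑ i, s i) ^ 2 ≤ Fintype.card ι * ∑ i, s i ^ 2 := sq_sum_le_card_mul_sum_sq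
  set S := ∑ i, s i
  set T := ∑ i, s i ^ 2
  have hT : 0 ≤ T := Finset.sum_nonneg fun _ _ => sq_nonneg _
  set n : ℝ := (Fintype.card ι : ℝ)
  have hn : 0 ≤ n := Nat.cast_nonneg _
  have h2 : (S + b + c) ^ 2 ≤ 3 * ((n + 1) * (T + b ^ 2 + c ^ 2)) := by
    nlinarith [sq_nonneg (S - b), sq_nonneg (S - c), sq_nonneg (b - c),
      mul_nonneg hn (sq_nonneg b), mul_nonneg hn (sq_nonneg c)]
  have h3 : (a * (S + b + c) + e * t) ^ 2 ≤ 2 * (a ^ 2 * (S + b + c) ^ 2) + 2 * (e * t) ^ 2 := by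
    nlinarith [sq_nonneg (a * (S + b + c) - e * t)]
  calc x ^ 2 ≤ (C * (a * (S + b + c) + e * t)) ^ 2 := pow_le_pow_left₀ hx h 2
    _ = C ^ 2 * (a * (S + b + c) + e * t) ^ 2 := by ring
    _ ≤ C ^ 2 * (2 * (a ^ 2 * (S + b + c) ^ 2) + 2 * (e * t) ^ 2) := by gcongr
    _ ≤ C ^ 2 * (2 * (a ^ 2 * (3 * ((n + 1) * (T + b ^ 2 + c ^ 2)))) + 2 * (e * t) ^ 2) := by gcongr
    _ ≤ C ^ 2 * (2 * (a ^ 2 * (3 * ((n + 1) * (T + b ^ 2 + c ^ 2)))) +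
        6 * (n + 1) * (e * t) ^ 2) := by
        gcongr; linarith
    _ = _ := by ring

theorem localized_energy_estimate {N : ℕ} {X : Fin N → Ec d → Ec d}
    (hX : ∀ i, BddSmooth (X i)) {r : ℕ} (hr : 1 ≤ r) (hUH : UniformHormander X r) :
    ∃ C τ₀ : ℝ, 0 ≤ C ∧ 0 < τ₀ ∧ ∀ ε ∈ Set.Ioc 0 τ₀, ∀ τ ∈ Set.Ioc (0 : ℝ) 1,
      ∀ f : SchwartzMap (Ec d) ℂ,
      spectralEnergy (fun ξ => τ ^ (-(2 / r : ℝ) - 1) *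
          ((2 * π * τ) ^ 2 * ‖ξ‖ ^ 2 * bump τ ξ ^ 2)) f ≤
        ENNReal.ofReal (C * ε ^ (2 / r - 2 : ℝ)) *
          (∑ i, spectralEnergy (fun ξ => τ⁻¹ * bump τ ξ ^ 2) (vfSchwartz (X i) f) +
            spectralEnergy (fun ξ => τ⁻¹ * bump τ ξ ^ 2) f +
            spectralEnergy (fun _ => τ) f) +
        ENNReal.ofReal (C * ε ^ 2) *
          spectralEnergy (fun ξ => τ ^ (-(2 / r : ℝ) - 1) * bump₂ τ ξ ^ 2) f := by
  obtain ⟨C, τ₀, hC, hτ₀, h⟩ := localized_gradient_estimate hX hr hUH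
  refine ⟨d * (6 * C ^ 2 * (N + 1)), τ₀, by positivity, hτ₀, fun ε hε τ hτ f => ?_⟩
  have hτ0 := hτ.1
  have hε0 := hε.1
  set K : ℝ := 6 * C ^ 2 * (N + 1) with hK
  have hK0 : 0 ≤ K := by positivity
  have key : ∀ k, (τ * schwartzL2 d (pDeriv k (fMul (bump τ) f))) ^ 2 ≤
      K * ((ε ^ (2 / r - 2 : ℝ) * τ ^ (2 / r : ℝ)) *
        (∑ i, schwartzL2 d (fMul (bump τ) (vfSchwartz (X i) f)) ^ 2 +
          schwartzL2 d (fMul (bump τ) f) ^ 2 + τ ^ 2 * schwartzL2 d f ^ 2) +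
        ε ^ 2 * schwartzL2 d (fMul (bump₂ τ) f) ^ 2) := fun k => by
    have := sq_le_of_le_mul_add (mul_nonneg hτ0.le (apply_nonneg _ _)) (h ε hε τ hτ f k)
    rw [Fintype.card_fin, ← hK] at this
    refine this.trans_eq ?_
    rw [mul_pow, mul_pow, ← Real.rpow_mul_natCast hε0.le, ← Real.rpow_mul_natCast hτ0.le]
    congr 5 <;> push_cast <;> ring
  set w := τ ^ (-(2 / r : ℝ) - 1) with hw
  have hw0 : 0 ≤ w := (Real.rpow_pos_of_pos hτ0 _).le
  have hwτ : w * τ ^ (2 / r : ℝ) = τ⁻¹ := by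
    rw [hw, ← Real.rpow_add hτ0, ← Real.rpow_neg_one]; congr 1; ring
  rw [spectralEnergy_gradient (bump_temperate τ) hw0]
  have e1 : ∀ g, spectralEnergy (fun ξ => τ⁻¹ * bump τ ξ ^ 2) g =
      ENNReal.ofReal (τ⁻¹ * schwartzL2 d (fMul (bump τ) g) ^ 2) := fun g =>
    (ofReal_mul_schwartzL2_fMul_sq (bump_temperate τ) (inv_nonneg.2 hτ0.le) g).symm
  have e2 : spectralEnergy (fun _ => τ) f = ENNReal.ofReal (τ * schwartzL2 d f ^ 2) := by
    have := ofReal_mul_schwartzL2_fMul_sq (Function.HasTemperateGrowth.const (1 : ℝ)) hτ0.le f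
    rw [fMul_one] at this
    rw [this]; simp
  have e3 := ofReal_mul_schwartzL2_fMul_sq (bump₂_temperate τ) hw0 f
  rw [← e3, e2]
  simp only [e1]
  have i0 : 0 ≤ τ⁻¹ := inv_nonneg.2 hτ0.le
  have m1 : ∀ g, 0 ≤ τ⁻¹ * schwartzL2 d (fMul (bump τ) g) ^ 2 := fun g => by positivity
  have m2 : 0 ≤ τ * schwartzL2 d f ^ 2 := by positivity
  have m3 : 0 ≤ w * schwartzL2 d (fMul (bump₂ τ) f) ^ 2 := by positivity
  have m4 := Finset.sum_nonneg fun i (_ : i ∈ univ) => m1 (vfSchwartz (X i) f)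
  have m5 := Real.rpow_pos_of_pos hε0 (2 / r - 2 : ℝ)
  rw [← ENNReal.ofReal_sum_of_nonneg fun i _ => m1 _, ← ENNReal.ofReal_add m4 (m1 _),
    ← ENNReal.ofReal_add (add_nonneg m4 (m1 _)) m2, ← ENNReal.ofReal_mul (by positivity),
    ← ENNReal.ofReal_mul (by positivity), ← ENNReal.ofReal_add
      (mul_nonneg (by positivity) (add_nonneg (add_nonneg m4 (m1 _)) m2)) (by positivity)]
  refine ENNReal.ofReal_le_ofReal ?_
  refine (mul_le_mul_of_nonneg_left (Finset.sum_le_sum fun k _ => key k) hw0).trans_eq ?_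
  rw [Finset.sum_const, Finset.card_univ, Fintype.card_fin, nsmul_eq_mul, ← Finset.mul_sum]
  generalize schwartzL2 d (fMul (bump₂ τ) f) = z
  generalize schwartzL2 d (fMul (bump τ) f) = y
  generalize schwartzL2 d f = x
  have : τ⁻¹ * τ ^ 2 = τ := by field_simp
  generalize ∑ i, schwartzL2 d (fMul (bump τ) (vfSchwartz (X i) f)) ^ 2 = S
  calc _ = d * K * ε ^ (2 / r - 2 : ℝ) * ((w * τ ^ (2 / r : ℝ)) * (S + y ^ 2 + τ ^ 2 * x ^ 2)) +
        d * K * ε ^ 2 * (w * z ^ 2) := by ring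
    _ = d * K * ε ^ (2 / r - 2 : ℝ) * (τ⁻¹ * S + τ⁻¹ * y ^ 2 + (τ⁻¹ * τ ^ 2) * x ^ 2) +
        d * K * ε ^ 2 * (w * z ^ 2) := by rw [hwτ]; ring
    _ = _ := by rw [this]

end

/-- The radial profile of `bump`. -/
def profile (l : ℝ) : ℝ := l ^ 2 / (1 + l ^ 2) ^ 2

theorem profile_nonneg (l : ℝ) : 0 ≤ profile l := by unfold profile; positivity

theorem profile_le_one (l : ℝ) : profile l ≤ 1 := by
  unfold profile
  rw [div_le_one (by positivity)]
  nlinarith [sq_nonneg l, sq_nonneg (l ^ 2)]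

theorem profile_le_sq (l : ℝ) : profile l ≤ l ^ 2 := by
  unfold profile
  refine div_le_self (sq_nonneg l) ?_
  nlinarith [sq_nonneg l, sq_nonneg (l ^ 2)]

theorem sq_mul_profile_le_one (l : ℝ) : l ^ 2 * profile l ≤ 1 := by
  unfold profile
  rw [← mul_div_assoc, div_le_one (by positivity)]
  nlinarith [sq_nonneg l, sq_nonneg (l ^ 2)]

theorem le_sq_mul_profile_sq {l : ℝ} (h1 : 1 / 2 ≤ l) (h2 : l ≤ 1) :
    1 / 1024 ≤ l ^ 2 * profile l ^ 2 := by
  have h3 : 1 / 4 ≤ l ^ 2 := by nlinarith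
  have h4 : l ^ 2 ≤ 1 := by nlinarith
  have h5 : 1 / 16 ≤ profile l := by
    unfold profile
    rw [le_div_iff₀ (by positivity)]
    nlinarith
  calc (1 : ℝ) / 1024 = 1 / 4 * (1 / 16) ^ 2 := by norm_num
    _ ≤ _ := by gcongr

theorem lower_scale_integral {s R : ℝ} (hs : 0 < s) (hR : 1 ≤ R) :
    ENNReal.ofReal (R ^ s / 2048) ≤
      ∫⁻ τ in Set.Ioc (0 : ℝ) 1, ENNReal.ofReal (τ ^ (-s - 1) *
        ((τ * R) ^ 2 * profile (τ * R) ^ 2)) := by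
  have hR0 : 0 < R := by linarith
  have hsub : Set.Ioc (1 / (2 * R)) (1 / R) ⊆ Set.Ioc (0 : ℝ) 1 := fun τ hτ =>
    ⟨lt_trans (by positivity) hτ.1, hτ.2.trans (by rw [div_le_one hR0]; exact hR)⟩
  calc ENNReal.ofReal (R ^ s / 2048)
      = ENNReal.ofReal (R ^ (s + 1) / 1024) * volume (Set.Ioc (1 / (2 * R)) (1 / R)) := by
        rw [Real.volume_Ioc, ← ENNReal.ofReal_mul (by positivity), Real.rpow_add_one hR0.ne']
        congr 1
        field_simp
        norm_num
    _ = ∫⁻ _ in Set.Ioc (1 / (2 * R)) (1 / R), ENNReal.ofReal (R ^ (s + 1) / 1024) := by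
        rw [setLIntegral_const]
    _ ≤ ∫⁻ τ in Set.Ioc (1 / (2 * R)) (1 / R), ENNReal.ofReal (τ ^ (-s - 1) *
        ((τ * R) ^ 2 * profile (τ * R) ^ 2)) := by
        refine setLIntegral_mono' measurableSet_Ioc fun τ hτ => ENNReal.ofReal_le_ofReal ?_
        have hτ0 : 0 < τ := (hsub hτ).1
        have h1 : 1 / 2 ≤ τ * R := by
          have := hτ.1.le
          rw [div_le_iff₀ (by positivity)] at this
          linarith
        have h2 : τ * R ≤ 1 := by
          have := hτ.2
          rwa [le_div_iff₀ hR0] at this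
        have h3 : R ^ (s + 1) ≤ τ ^ (-s - 1) := by
          have h4 : R ≤ τ⁻¹ := by
            have := hτ.2
            rwa [← one_div, le_div_iff₀ hτ0, mul_comm, ← le_div_iff₀ hR0]
          calc R ^ (s + 1) ≤ τ⁻¹ ^ (s + 1) := Real.rpow_le_rpow hR0.le h4 (by linarith)
            _ = _ := by rw [Real.inv_rpow hτ0.le, ← Real.rpow_neg hτ0.le]; congr 1; ring
        rw [div_eq_mul_one_div]
        exact mul_le_mul h3 (le_sq_mul_profile_sq h1 h2) (by norm_num) (by positivity)
    _ ≤ _ := lintegral_mono_set hsub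

theorem upper_scale_integral {s R : ℝ} (hs : 0 < s) (hs2 : s ≤ 2) (hR : 0 ≤ R) :
    ∫⁻ τ in Set.Ioc (0 : ℝ) 1, ENNReal.ofReal (τ ^ (-s - 1) *
        ((τ * R) ^ 2 * profile (τ * R)) ^ 2) ≤ ENNReal.ofReal ((1 + 1 / s) * R ^ s) := by
  rcases hR.eq_or_lt with rfl | hR0
  · simp
  have hsub : Set.Ioc (0 : ℝ) 1 ⊆ Set.Ioc 0 (1 / R) ∪ Set.Ioi (1 / R) := fun τ hτ => by
    rcases le_or_gt τ (1 / R) with h | h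
    · exact Or.inl ⟨hτ.1, h⟩
    · exact Or.inr h
  refine (lintegral_mono_set hsub).trans ((lintegral_union_le _ _ _).trans ?_)
  have e : (1 + 1 / s) * R ^ s = R ^ s + R ^ s / s := by ring
  rw [e, ENNReal.ofReal_add (by positivity) (by positivity)]
  refine add_le_add ?_ ?_
  · calc _ ≤ ∫⁻ _ in Set.Ioc 0 (1 / R), ENNReal.ofReal (R ^ (s + 1)) := by
          refine setLIntegral_mono' measurableSet_Ioc fun τ hτ => ENNReal.ofReal_le_ofReal ?_
          have hτ0 : 0 < τ := hτ.1
          have hl : 0 < τ * R := by positivity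
          have h2 : τ * R ≤ 1 := by
            have := hτ.2
            rwa [le_div_iff₀ hR0] at this
          have h3 : ((τ * R) ^ 2 * profile (τ * R)) ^ 2 ≤ (τ * R) ^ (s + 1) := by
            calc _ ≤ ((τ * R) ^ 2 * (τ * R) ^ 2) ^ 2 := by
                  have := profile_nonneg (τ * R)
                  gcongr
                  exact profile_le_sq _
              _ = (τ * R) ^ (8 : ℝ) := by
                  rw [← Real.rpow_natCast, ← Real.rpow_natCast, ← Real.rpow_add hl,
                    ← Real.rpow_mul hl.le]
                  norm_num
              _ ≤ _ := Real.rpow_le_rpow_of_exponent_ge hl h2 (by linarith)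
          calc _ ≤ τ ^ (-s - 1) * (τ * R) ^ (s + 1) := by gcongr
            _ = (τ ^ (-s - 1) * τ ^ (s + 1)) * R ^ (s + 1) := by
                rw [Real.mul_rpow hτ0.le hR]; ring
            _ = _ := by rw [← Real.rpow_add hτ0]; simp
      _ = ENNReal.ofReal (R ^ s) := by
          rw [setLIntegral_const, Real.volume_Ioc, ← ENNReal.ofReal_mul (by positivity),
            Real.rpow_add_one hR0.ne']
          congr 1
          field_simp
          ring
  · calc _ ≤ ∫⁻ τ in Set.Ioi (1 / R), ENNReal.ofReal (τ ^ (-s - 1)) := by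
          refine setLIntegral_mono' measurableSet_Ioi fun τ hτ => ENNReal.ofReal_le_ofReal ?_
          have hτ0 : 0 < τ := lt_trans (by positivity) hτ
          refine mul_le_of_le_one_right (by positivity) (pow_le_one₀ ?_ (sq_mul_profile_le_one _))
          exact mul_nonneg (sq_nonneg _) (profile_nonneg _)
      _ = ENNReal.ofReal (R ^ s / s) := by
          have hp : 0 < 1 / R := by positivity
          rw [← ofReal_integral_eq_lintegral_ofReal
            (integrableOn_Ioi_rpow_of_lt (by linarith) hp)
            ((ae_restrict_iff' measurableSet_Ioi).2 (Filter.Eventually.of_forall fun τ hτ =>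
              (Real.rpow_pos_of_pos (lt_trans hp hτ) _).le)),
            integral_Ioi_rpow_of_lt (by linarith) hp]
          congr 1
          rw [one_div, Real.inv_rpow hR, ← Real.rpow_neg hR]
          have : -(-s - 1 + 1) = s := by ring
          rw [this]
          have : -s - 1 + 1 = -s := by ring
          rw [this, neg_div_neg_eq]

theorem profile_scale_integral {R : ℝ} :
    ∫⁻ τ in Set.Ioc (0 : ℝ) 1, ENNReal.ofReal (τ⁻¹ * profile (τ * R) ^ 2) ≤ 1 := by
  have hder : ∀ τ ∈ Set.uIcc (0 : ℝ) 1, HasDerivAt (fun τ : ℝ => -(2 * (1 + (τ * R) ^ 2))⁻¹)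
      (R ^ 2 * τ / (1 + (τ * R) ^ 2) ^ 2) τ := fun τ _ => by
    have hne : 2 * (1 + (τ * R) ^ 2) ≠ 0 := by positivity
    have h1 : HasDerivAt (fun τ : ℝ => 2 * (1 + (τ * R) ^ 2)) (4 * τ * R ^ 2) τ := by
      refine ((((hasDerivAt_id τ).mul_const R).pow 2).const_add 1).const_mul 2 |>.congr_deriv ?_
      simp; ring
    refine (h1.inv hne).neg.congr_deriv ?_
    field_simp
    ring
  have hcont : Continuous fun τ : ℝ => R ^ 2 * τ / (1 + (τ * R) ^ 2) ^ 2 :=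
    Continuous.div (by fun_prop) (by fun_prop) fun τ => by positivity
  calc _ ≤ ∫⁻ τ in Set.Ioc (0 : ℝ) 1, ENNReal.ofReal (R ^ 2 * τ / (1 + (τ * R) ^ 2) ^ 2) := by
        refine setLIntegral_mono' measurableSet_Ioc fun τ hτ => ENNReal.ofReal_le_ofReal ?_
        have hτ0 : 0 < τ := hτ.1
        have h0 := profile_nonneg (τ * R)
        calc τ⁻¹ * profile (τ * R) ^ 2 ≤ τ⁻¹ * profile (τ * R) := by
              gcongr; nlinarith [profile_le_one (τ * R)]
          _ = _ := by unfold profile; field_simp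
    _ = ENNReal.ofReal (∫ τ in (0 : ℝ)..1, R ^ 2 * τ / (1 + (τ * R) ^ 2) ^ 2) := by
        rw [intervalIntegral.integral_of_le zero_le_one, ofReal_integral_eq_lintegral_ofReal
          (hcont.integrableOn_Ioc) ((ae_restrict_iff' measurableSet_Ioc).2
            (Filter.Eventually.of_forall fun τ hτ => by
              have : 0 < τ := hτ.1
              positivity))]
    _ ≤ 1 := by
        rw [intervalIntegral.integral_eq_sub_of_hasDerivAt hder (hcont.intervalIntegrable _ _)]
        refine ENNReal.ofReal_le_one.2 ?_
        have : 0 ≤ (1 + R ^ 2)⁻¹ := by positivity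
        norm_num
        linarith

theorem linear_scale_integral : ∫⁻ τ in Set.Ioc (0 : ℝ) 1, ENNReal.ofReal τ ≤ 1 := by
  calc _ ≤ ∫⁻ _ in Set.Ioc (0 : ℝ) 1, (1 : ENNReal) :=
        setLIntegral_mono' measurableSet_Ioc fun τ hτ => ENNReal.ofReal_le_one.2 hτ.2
    _ = 1 := by simp

theorem bump_eq_profile (τ : ℝ) (ξ : Ec d) : bump τ ξ = profile (τ * (2 * π * ‖ξ‖)) := by
  rw [bump_eq, profile, res, div_eq_mul_inv, inv_pow]
  have : (2 * π * τ) ^ 2 * ‖ξ‖ ^ 2 = (τ * (2 * π * ‖ξ‖)) ^ 2 := by ring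
  rw [this]

section

open SchwartzMap

theorem measurable_enorm_fourier_sq (f : SchwartzMap (Ec d) ℂ) :
    Measurable fun ξ => ‖𝓕 f ξ‖ₑ ^ 2 := by
  have hfm : Measurable (fun ξ => 𝓕 f ξ) := (𝓕 f).continuous.measurable
  fun_prop

theorem measurable_spectralEnergy {K : ℝ → Ec d → ℝ}
    (hK : Measurable fun p : ℝ × Ec d => K p.1 p.2) (f : SchwartzMap (Ec d) ℂ) :
    Measurable fun τ => spectralEnergy (K τ) f := by
  have := measurable_enorm_fourier_sq f
  exact Measurable.lintegral_prod_right'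
    (f := fun p : ℝ × Ec d => ENNReal.ofReal (K p.1 p.2) * ‖𝓕 f p.2‖ₑ ^ 2)
    (hK.ennreal_ofReal.mul (this.comp measurable_snd))

theorem lintegral_spectralEnergy {K : ℝ → Ec d → ℝ}
    (hK : Measurable fun p : ℝ × Ec d => K p.1 p.2) (f : SchwartzMap (Ec d) ℂ) :
    ∫⁻ τ in Set.Ioc (0 : ℝ) 1, spectralEnergy (K τ) f =
      ∫⁻ ξ, (∫⁻ τ in Set.Ioc (0 : ℝ) 1, ENNReal.ofReal (K τ ξ)) * ‖𝓕 f ξ‖ₑ ^ 2 := by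
  have := measurable_enorm_fourier_sq f
  unfold spectralEnergy
  rw [lintegral_lintegral_swap]
  · refine lintegral_congr fun ξ => lintegral_mul_const' _ _ (by finiteness)
  · exact (hK.ennreal_ofReal.mul (this.comp measurable_snd)).aemeasurable

theorem measurable_bump : Measurable fun p : ℝ × Ec d => bump p.1 p.2 := by
  unfold bump res; fun_prop

theorem measurable_bump₂ : Measurable fun p : ℝ × Ec d => bump₂ p.1 p.2 := by
  have := measurable_bump (d := d)
  unfold bump₂; fun_prop

theorem spectralEnergy_one (f : SchwartzMap (Ec d) ℂ) :
    spectralEnergy (fun _ => 1) f = ENNReal.ofReal (schwartzL2 d f ^ 2) := by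
  rw [← schwartzL2_fourier, ofReal_schwartzL2_sq]
  simp [spectralEnergy]

theorem spectralEnergy_mono {σ ρ : Ec d → ℝ} (h : ∀ ξ, σ ξ ≤ ρ ξ) (f : SchwartzMap (Ec d) ℂ) :
    spectralEnergy σ f ≤ spectralEnergy ρ f :=
  lintegral_mono fun ξ => by gcongr; exact h ξ

theorem spectralEnergy_rpow_ne_top {s : ℝ} (hs : 0 ≤ s) (hs2 : s ≤ 2)
    (f : SchwartzMap (Ec d) ℂ) :
    spectralEnergy (fun ξ => (2 * π * ‖ξ‖) ^ s) f ≠ ⊤ := by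
  have h : (fun ξ : Ec d => 1 + (2 * π * 1) ^ 2 * ‖ξ‖ ^ 2).HasTemperateGrowth := denom_temperate 1
  have h2 := ofReal_mul_schwartzL2_fMul_sq h zero_le_one f
  refine ne_top_of_le_ne_top (h2 ▸ ENNReal.ofReal_ne_top) (spectralEnergy_mono (fun ξ => ?_) f)
  set R := 2 * π * ‖ξ‖ with hR
  have hR0 : 0 ≤ R := by positivity
  have e : 1 * (1 + (2 * π * 1) ^ 2 * ‖ξ‖ ^ 2) ^ 2 = (1 + R ^ 2) ^ 2 := by rw [hR]; ring
  rw [e]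
  have h3 : R ^ s ≤ 1 + R ^ 2 := by
    rcases le_total R 1 with h | h
    · exact (Real.rpow_le_one hR0 h hs).trans (by nlinarith)
    · exact (Real.rpow_le_rpow_of_exponent_le h hs2).trans (by
        rw [Real.rpow_two]; linarith)
  nlinarith [sq_nonneg R]

theorem spectralEnergy_rpow_le {s : ℝ} (hs : 0 < s) (f : SchwartzMap (Ec d) ℂ) :
    ENNReal.ofReal (1 / 2048) * spectralEnergy (fun ξ => (2 * π * ‖ξ‖) ^ s) f ≤
      spectralEnergy (fun _ => 1) f + ∫⁻ τ in Set.Ioc (0 : ℝ) 1,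
        spectralEnergy (fun ξ => τ ^ (-s - 1) *
          ((2 * π * τ) ^ 2 * ‖ξ‖ ^ 2 * bump τ ξ ^ 2)) f := by
  have hb := measurable_bump (d := d)
  rw [lintegral_spectralEnergy (K := fun τ ξ => τ ^ (-s - 1) *
    ((2 * π * τ) ^ 2 * ‖ξ‖ ^ 2 * bump τ ξ ^ 2)) (by fun_prop),
    ← spectralEnergy_const_mul (by norm_num)]
  have := measurable_enorm_fourier_sq f
  unfold spectralEnergy
  rw [← lintegral_add_left (by fun_prop)]
  refine lintegral_mono fun ξ => ?_
  simp only
  rw [← add_mul]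
  gcongr
  have hR0 : 0 ≤ 2 * π * ‖ξ‖ := by positivity
  rcases le_total (2 * π * ‖ξ‖) 1 with h | h
  · refine le_trans (ENNReal.ofReal_le_ofReal ?_) le_self_add
    have := Real.rpow_le_one hR0 h hs.le
    linarith
  · refine le_trans ?_ le_add_self
    refine le_trans (le_of_eq ?_) ((lower_scale_integral hs h).trans_eq ?_)
    · congr 1; ring
    · refine lintegral_congr fun τ => ?_
      rw [bump_eq_profile]
      congr 3; ring

theorem lintegral_spectralEnergy_bump_le (f : SchwartzMap (Ec d) ℂ) :
    ∫⁻ τ in Set.Ioc (0 : ℝ) 1, spectralEnergy (fun ξ => τ⁻¹ * bump τ ξ ^ 2) f ≤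
      spectralEnergy (fun _ => 1) f := by
  have hb := measurable_bump (d := d)
  rw [lintegral_spectralEnergy (K := fun τ ξ => τ⁻¹ * bump τ ξ ^ 2) (by fun_prop)]
  refine lintegral_mono fun ξ => ?_
  simp only [ENNReal.ofReal_one]
  gcongr
  simp only [bump_eq_profile]
  exact profile_scale_integral

theorem lintegral_spectralEnergy_const_le (f : SchwartzMap (Ec d) ℂ) :
    ∫⁻ τ in Set.Ioc (0 : ℝ) 1, spectralEnergy (fun _ => τ) f ≤ spectralEnergy (fun _ => 1) f := by
  rw [lintegral_spectralEnergy (K := fun τ _ => τ) (by fun_prop)]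
  refine lintegral_mono fun ξ => ?_
  simp only [ENNReal.ofReal_one]
  gcongr
  exact linear_scale_integral

theorem lintegral_spectralEnergy_bump₂_le {s : ℝ} (hs : 0 < s) (hs2 : s ≤ 2)
    (f : SchwartzMap (Ec d) ℂ) :
    ∫⁻ τ in Set.Ioc (0 : ℝ) 1, spectralEnergy (fun ξ => τ ^ (-s - 1) * bump₂ τ ξ ^ 2) f ≤
      ENNReal.ofReal (1 + 1 / s) * spectralEnergy (fun ξ => (2 * π * ‖ξ‖) ^ s) f := by
  have hb := measurable_bump₂ (d := d)
  rw [lintegral_spectralEnergy (K := fun τ ξ => τ ^ (-s - 1) * bump₂ τ ξ ^ 2) (by fun_prop),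
    ← spectralEnergy_const_mul (by positivity)]
  refine lintegral_mono fun ξ => ?_
  simp only
  gcongr
  refine le_trans (le_of_eq (lintegral_congr fun τ => ?_))
    (upper_scale_integral hs hs2 (R := 2 * π * ‖ξ‖) (by positivity))
  rw [bump₂, bump_eq_profile]
  congr 4; ring

theorem spectralEnergy_subelliptic {N : ℕ} {X : Fin N → Ec d → Ec d}
    (hX : ∀ i, BddSmooth (X i)) {r : ℕ} (hr : 1 ≤ r) (hUH : UniformHormander X r) :
    ∃ c : ℝ, 0 < c ∧ ∀ f : SchwartzMap (Ec d) ℂ,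
      spectralEnergy (fun ξ => (2 * π * ‖ξ‖) ^ (2 / r : ℝ)) f ≤
        ENNReal.ofReal (c * (schwartzL2 d f ^ 2 + ∑ i, schwartzL2 d (vfSchwartz (X i) f) ^ 2)) := by
  obtain ⟨C, τ₀, hC, hτ₀, h⟩ := localized_energy_estimate hX hr hUH
  have hr' : (1 : ℝ) ≤ r := by exact_mod_cast hr
  set s : ℝ := 2 / r with hs_def
  have hs : 0 < s := by positivity
  have hs2 : s ≤ 2 := div_le_self zero_le_two hr'
  set D : ℝ := 4096 * (C * (1 + 1 / s)) with hD
  have hD0 : 0 ≤ D := by positivity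
  set ε : ℝ := min τ₀ (1 / (D + 1)) with hε
  have hε0 : 0 < ε := lt_min hτ₀ (by positivity)
  have hε1 : ε * (D + 1) ≤ 1 := by
    rw [← le_div_iff₀ (by positivity)]; exact min_le_right _ _
  have hDε : D * ε ^ 2 ≤ 1 := by
    have h1 : ε ≤ 1 := by nlinarith
    nlinarith [mul_nonneg hD0 hε0.le]
  set B : ℝ := C * ε ^ (s - 2) with hB
  have hB0 : 0 ≤ B := mul_nonneg hC (Real.rpow_pos_of_pos hε0 _).le
  refine ⟨4096 * (1 + 2 * B), by positivity, fun f => ?_⟩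
  set Q := spectralEnergy (fun ξ => (2 * π * ‖ξ‖) ^ s) f with hQ
  have hQt : Q ≠ ⊤ := spectralEnergy_rpow_ne_top hs.le hs2 f
  have hb := measurable_bump (d := d)
  have hb2 := measurable_bump₂ (d := d)
  have m1 : ∀ g : SchwartzMap (Ec d) ℂ,
      Measurable fun τ : ℝ => spectralEnergy (fun ξ => τ⁻¹ * bump τ ξ ^ 2) g := fun g =>
    measurable_spectralEnergy (K := fun τ ξ => τ⁻¹ * bump τ ξ ^ 2) (by fun_prop) g
  have m2 : Measurable fun τ : ℝ => spectralEnergy (fun _ => τ) f :=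
    measurable_spectralEnergy (K := fun τ _ => τ) (by fun_prop) f
  have m3 : Measurable fun τ : ℝ => spectralEnergy (fun ξ => τ ^ (-s - 1) * bump₂ τ ξ ^ 2) f :=
    measurable_spectralEnergy (K := fun τ ξ => τ ^ (-s - 1) * bump₂ τ ξ ^ 2) (by fun_prop) f
  have key := calc
    ENNReal.ofReal (1 / 2048) * Q ≤ _ := spectralEnergy_rpow_le hs f
    _ ≤ spectralEnergy (fun _ => 1) f + ∫⁻ τ in Set.Ioc (0 : ℝ) 1, (ENNReal.ofReal B *
          (∑ i, spectralEnergy (fun ξ => τ⁻¹ * bump τ ξ ^ 2) (vfSchwartz (X i) f) +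
            spectralEnergy (fun ξ => τ⁻¹ * bump τ ξ ^ 2) f +
            spectralEnergy (fun _ => τ) f) +
        ENNReal.ofReal (C * ε ^ 2) *
          spectralEnergy (fun ξ => τ ^ (-s - 1) * bump₂ τ ξ ^ 2) f) := by
        refine add_le_add le_rfl (setLIntegral_mono' measurableSet_Ioc fun τ hτ => ?_)
        exact h ε ⟨hε0, min_le_left _ _⟩ τ hτ f
    _ = spectralEnergy (fun _ => 1) f + (ENNReal.ofReal B *
          (∑ i, (∫⁻ τ in Set.Ioc (0 : ℝ) 1,
              spectralEnergy (fun ξ => τ⁻¹ * bump τ ξ ^ 2) (vfSchwartz (X i) f)) +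
            (∫⁻ τ in Set.Ioc (0 : ℝ) 1, spectralEnergy (fun ξ => τ⁻¹ * bump τ ξ ^ 2) f) +
            ∫⁻ τ in Set.Ioc (0 : ℝ) 1, spectralEnergy (fun _ => τ) f) +
        ENNReal.ofReal (C * ε ^ 2) * ∫⁻ τ in Set.Ioc (0 : ℝ) 1,
          spectralEnergy (fun ξ => τ ^ (-s - 1) * bump₂ τ ξ ^ 2) f) := by
        rw [lintegral_add_right _ (by fun_prop), lintegral_const_mul' _ _ ENNReal.ofReal_ne_top,
          lintegral_const_mul' _ _ ENNReal.ofReal_ne_top, lintegral_add_right _ m2,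
          lintegral_add_right _ (m1 f), lintegral_finsetSum _ fun i _ => m1 _]
    _ ≤ spectralEnergy (fun _ => 1) f + (ENNReal.ofReal B *
          (∑ i, spectralEnergy (fun _ => 1) (vfSchwartz (X i) f) +
            spectralEnergy (fun _ => 1) f + spectralEnergy (fun _ => 1) f) +
        ENNReal.ofReal (C * ε ^ 2) * (ENNReal.ofReal (1 + 1 / s) * Q)) := by
        gcongr
        · exact lintegral_spectralEnergy_bump_le _
        · exact lintegral_spectralEnergy_bump_le _
        · exact lintegral_spectralEnergy_const_le _
        · exact lintegral_spectralEnergy_bump₂_le hs hs2 f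
  simp only [spectralEnergy_one] at key
  obtain ⟨q, hq0, hq⟩ : ∃ q : ℝ, 0 ≤ q ∧ Q = ENNReal.ofReal q :=
    ⟨Q.toReal, ENNReal.toReal_nonneg, (ENNReal.ofReal_toReal hQt).symm⟩
  clear_value Q
  subst hq
  rw [← ENNReal.ofReal_sum_of_nonneg fun i _ => sq_nonneg _] at key
  have hS : 0 ≤ ∑ i, schwartzL2 d (vfSchwartz (X i) f) ^ 2 :=
    Finset.sum_nonneg fun _ _ => sq_nonneg _
  have hx : 0 ≤ schwartzL2 d f ^ 2 := sq_nonneg _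
  generalize ∑ i, schwartzL2 d (vfSchwartz (X i) f) ^ 2 = S at *
  generalize schwartzL2 d f ^ 2 = x at *
  rw [← ENNReal.ofReal_add hS hx, ← ENNReal.ofReal_add (by positivity) hx,
    ← ENNReal.ofReal_mul (by positivity), ← ENNReal.ofReal_mul (by positivity),
    ← ENNReal.ofReal_mul (by positivity), ← ENNReal.ofReal_mul (by positivity),
    ← ENNReal.ofReal_add (by positivity) (by positivity),
    ← ENNReal.ofReal_add hx (by positivity), ENNReal.ofReal_le_ofReal_iff (by positivity)] at key
  refine ENNReal.ofReal_le_ofReal ?_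
  have h1 : 4096 * (C * ε ^ 2 * ((1 + 1 / s) * q)) ≤ q := by
    calc _ = D * ε ^ 2 * q := by rw [hD]; ring
      _ ≤ 1 * q := by gcongr
      _ = q := one_mul q
  nlinarith [mul_nonneg hB0 hS, mul_nonneg hB0 hx]

end

theorem l2norm_sq_eq_schwartzL2_sq (f : SchwartzMap (Ec d) ℂ) :
    l2norm f ^ 2 = schwartzL2 d f ^ 2 := by
  rw [l2norm, Real.sq_sqrt (integral_nonneg fun x => sq_nonneg _),
    integral_eq_lintegral_of_nonneg_ae (ae_of_all _ fun x => sq_nonneg _)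
      (by have := f.continuous; fun_prop),
    ← ENNReal.toReal_ofReal (sq_nonneg (schwartzL2 d f)), ofReal_schwartzL2_sq]
  congr 1
  refine lintegral_congr fun x => ?_
  rw [ENNReal.ofReal_pow (norm_nonneg _), ofReal_norm]

theorem integral_mul_norm_fourier_sq (σ : Ec d → ℝ) (hσ : ∀ ξ, 0 ≤ σ ξ) (hm : Measurable σ)
    (f : SchwartzMap (Ec d) ℂ) :
    ∫ ξ, σ ξ * ‖𝓕 f ξ‖ ^ 2 = (spectralEnergy σ f).toReal := by
  have hf : Measurable fun ξ => 𝓕 f ξ := (𝓕 f).continuous.measurable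
  rw [integral_eq_lintegral_of_nonneg_ae
    (ae_of_all _ fun ξ => mul_nonneg (hσ ξ) (sq_nonneg _))
    (hm.mul (hf.norm.pow_const 2)).aestronglyMeasurable, spectralEnergy]
  congr 1
  refine lintegral_congr fun ξ => ?_
  rw [ENNReal.ofReal_mul (hσ ξ), ENNReal.ofReal_pow (norm_nonneg _), ofReal_norm]

/-- **Hörmander-type subelliptic estimate
(Proposition 4.10 of ter Elst–Robinson, "Uniform subellipticity").**
Let `X₁,…,X_N` be `C_b^∞`-vector fields on `ℝ^d` satisfying the uniform Hörmander
condition of order `r`.  Then there is a `c > 0` with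
`‖Δ^{1/(2r)}φ‖₂² = ∫ (4π²|ξ|²)^{1/r} |φ̂(ξ)|² dξ ≤ c (‖φ‖₂² + ∑_{i=1}^N ‖X_iφ‖₂²)`
for all `φ ∈ C_c^∞(ℝ^d)`; that is, `H₀ = ∑ X_i^* X_i` is subelliptic of order `1/r`. -/
theorem hormander_subelliptic_estimate (d N r : ℕ) (hr : 1 ≤ r)
    (X : Fin N → Ec d → Ec d) (hX : ∀ i, IsCbVF (X i))
    (hUH : UniformHormander X r) :
    ∃ c : ℝ, 0 < c ∧ ∀ φ : Ec d → ℂ, IsCc φ →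
      (∫ ξ : Ec d, (4 * π ^ 2 * ‖ξ‖ ^ 2) ^ (2 * (1 / (2 * (r : ℝ)))) * ‖𝓕 φ ξ‖ ^ 2) ≤
        c * (l2norm φ ^ 2 + ∑ i, l2norm (vfApply (X i) φ) ^ 2) := by
  obtain ⟨c, hc, h⟩ := spectralEnergy_subelliptic (X := X) hX hr hUH
  refine ⟨c, hc, fun φ hφ => ?_⟩
  set f : SchwartzMap (Ec d) ℂ := hφ.2.toSchwartzMap hφ.1 with hf
  have hfφ : ⇑f = φ := rfl
  have hσ : (fun ξ : Ec d => (4 * π ^ 2 * ‖ξ‖ ^ 2) ^ (2 * (1 / (2 * (r : ℝ))))) =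
      fun ξ => (2 * π * ‖ξ‖) ^ (2 / r : ℝ) := by
    ext ξ
    have h0 : 0 ≤ 2 * π * ‖ξ‖ := by positivity
    rw [show 4 * π ^ 2 * ‖ξ‖ ^ 2 = (2 * π * ‖ξ‖) ^ (2 : ℝ) by rw [Real.rpow_two]; ring,
      ← Real.rpow_mul h0]
    congr 1
    have : (r : ℝ) ≠ 0 := by positivity
    field_simp
  have hF : ∀ ξ, 𝓕 φ ξ = 𝓕 f ξ := fun ξ => by rw [← hfφ, SchwartzMap.fourier_coe]
  have hl : ∀ i, l2norm (vfApply (X i) φ) = l2norm (vfSchwartz (X i) f) := fun i => by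
    rw [vfSchwartz_apply (hX i), hfφ]
  simp only [hF, hl, l2norm_sq_eq_schwartzL2_sq]
  rw [← hfφ, l2norm_sq_eq_schwartzL2_sq]
  have := integral_mul_norm_fourier_sq _ (fun ξ => by positivity)
    (show Measurable fun ξ : Ec d => (4 * π ^ 2 * ‖ξ‖ ^ 2) ^ (2 * (1 / (2 * (r : ℝ)))) by
      fun_prop) f
  rw [this, hσ]
  exact ENNReal.toReal_le_of_le_ofReal (by positivity) (h f)

end
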